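/- Let n ≥ 3 and let λ, μ, ν be integers with 0 < λ ≤ μ ≤ ν ≤ λ + μ and ν ≥ 3. Over an algebraically closed field 𝕜 of characteristic 2, let a, b, c, f ∈ 𝕜[u_0,…,u_{n−1}] be general homogeneous polynomials of degrees −λ+μ+ν, λ−μ+ν, λ+μ−ν, ν respectively, let R be the ℙ(1,1,2)-bundle over ℙ^{n−1} with Cox coordinates u_0,…,u_{n−1} of bidegree (1,0) and x, y, z̄ of bidegrees (λ,1), (μ,1), (2ν,2), let Z ⊂ R be the hypersurface a x² + b y² + c z̄ + f x y = 0, and set Z° = Z ∖ (Z ∩ (x = y = 0)) and 𝓛 = 𝒪_Z(ν,1). Then the section z̄ ∈ H⁰(Z, 𝓛²) has only admissible critical points on Z°. -/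

import Mathlib

/-!
Formalization framework for "Stable rationality of higher dimensional conic bundles"
(Ahmadinezhad–Okada).

We model a weighted-projective-space bundle `P` over `ℙ^{n-1}` (in particular the
`ℙ²`-bundle `P_n(k,l,m) = ℙ(𝒪(-k) ⊕ 𝒪(-l) ⊕ 𝒪(-m))`, and the `ℙ(1,1,2)`-bundle `R`)
through its Cox ring `K[u_0,…,u_{n-1}, x_0,…,x_{m-1}]`, bigraded by
`deg u_i = (1,0)`, `deg x_j = (w j, a j)`, together with the action of the
two-dimensional torus on the affine cone.  A member `X` of the complete linear
system `|𝒪_P(α,β)| = |α F + β D|` (`F` the pullback of the hyperplane class of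
`ℙ^{n-1}`, `D` the tautological class) is recorded by a bihomogeneous polynomial
`g` of bidegree `(α,β)`, and the projection `π : X → ℙ^{n-1}` is induced by the
coordinates `u_0,…,u_{n-1}`.

Geometric notions are rendered as follows (all are genuine definitions):

* a *general* (resp. *very general*) member of a linear system: the property holds
  on a nonempty principal Zariski-open subset of the parameter space (resp. away
  from countably many proper closed subsets);
* smoothness of `X`: the Jacobian criterion on the punctured affine cone (where the
  torus acts freely the quotient map is a torsor, so this is smoothness of `X`);
* the function field `K(X)`: the degree-`(0,0)` part of the fraction field of the
  homogeneous coordinate ring `Cox/(g)`, i.e. the subalgebra generated by ratios of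
  bihomogeneous elements of equal bidegree;
* rationality: `K(X)` is `K`-isomorphic to a purely transcendental extension of
  `K` (i.e. `X` is birational to a projective space);
* stable rationality: `K(X)(x_1,…,x_r) ≅_K K(y_1,…,y_s)` for some `r,s`
  (i.e. `X × ℙ^r` is birational to a projective space);
* normality: the local rings of the relevant locus of the affine cone are
  integrally closed (the punctured cone is a smooth torsor over `X`);
* terminal singularities: rendered as `X` normal with singular locus of
  codimension at least 3, which is the form terminality takes for the general
  members appearing in the paper;
* ℚ-factoriality together with `ρ(X) = 2` (i.e. the divisor class group of `X` is
  spanned up to torsion by the fibre class `F` and the tautological class `D`):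
  rendered by requiring every relevant bihomogeneous height-one prime `P` of the
  coordinate ring of `X` to contain a bihomogeneous element lying in no other such
  prime (so that `div(f) = k·P` and `[P] ∈ ℚ⟨F, D⟩`);
* ampleness of `𝒪_X(α,β)`: some multiple is very ample, rendered by requiring the
  bihomogeneous sections of that multiple to be base point free, to separate
  points, and to separate tangent vectors (modulo the torus directions) on the
  cone over `X`;
* `π`-ampleness of `-K_X`: by adjunction `-K_X = 𝒪_X(e,1)` with
  `e = n + Σ w - deg g`, and relative ampleness over the projective base means
  some twist `𝒪_X(e+N,1)` by pullback classes from `ℙ^{n-1}` is ample;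
* connectedness of the fibres of `π : X → ℙ^{n-1}`: no fibre admits a disjoint
  covering by two zero sets of families of weighted-homogeneous polynomials, each
  meeting the fibre (i.e. Zariski-connectedness of the fibres), and all fibres are
  nonempty;
* a conic bundle (Mori fibre space of relative dimension one, Definition 2.5 of
  the paper): `X` is irreducible (the ideal of `g` is prime), normal, has only
  terminal singularities, `π` has connected fibres, `-K_X` is `π`-ample, and
  `ρ(X) = 2`; all in the above renderings.
-/

open MvPolynomial

set_option maxHeartbeats 1600000
set_option synthInstance.maxHeartbeats 400000

namespace ConicBundleFormalization

noncomputable section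

variable (K : Type) [Field K]

/-! ### The Cox ring and bihomogeneity -/

/-- The Cox ring of an `(m-1)`-dimensional weighted-projective-space bundle over
`ℙ^{n-1}`: variables `u_i` (`i : Fin n`) of bidegree `(1,0)` and fibre variables
`x_j` (`j : Fin m`) of bidegree `(w j, a j)`. -/
abbrev Cox (n m : ℕ) : Type := MvPolynomial (Fin n ⊕ Fin m) K

/-- `p` is bihomogeneous of bidegree `(α, β)` for the grading `deg u_i = (1,0)`,
`deg x_j = (w j, a j)`. -/
def IsBihom (n m : ℕ) (w : Fin m → ℤ) (a : Fin m → ℕ) (α : ℤ) (β : ℕ)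
    (p : Cox K n m) : Prop :=
  ∀ e ∈ p.support,
    ((∑ i : Fin n, (e (Sum.inl i) : ℤ)) + ∑ j : Fin m, (e (Sum.inr j) : ℤ) * w j = α) ∧
    ((∑ j : Fin m, e (Sum.inr j) * a j) = β)

/-- A polynomial in `u_0, …, u_{n-1}` is homogeneous of degree `d ∈ ℤ`
(for `d < 0` this forces `p = 0`). -/
def IsHomogZ (n : ℕ) (d : ℤ) (p : MvPolynomial (Fin n) K) : Prop :=
  ∀ e ∈ p.support, (∑ i : Fin n, (e i : ℤ)) = d

/-- A polynomial in the fibre variables is weighted-homogeneous of degree `e` for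
the weights `a`. -/
def IsWHom (m : ℕ) (a : Fin m → ℕ) (e : ℕ) (q : MvPolynomial (Fin m) K) : Prop :=
  ∀ ex ∈ q.support, (∑ j : Fin m, ex j * a j) = e

/-! ### Genericity: general and very general members of a linear system -/

/-- Evaluation of a polynomial `D` in the coefficients of `p`; such `D` are the
polynomial functions on the parameter space of the linear system. -/
def evalCoeff {n m : ℕ} (p : Cox K n m)
    (D : MvPolynomial ((Fin n ⊕ Fin m) →₀ ℕ) K) : K :=
  MvPolynomial.eval (fun e => p.coeff e) D

/-- `Pred` holds for a *general* member of the complete linear system of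
bihomogeneous polynomials of bidegree `(α,β)`: it holds on a nonempty principal
Zariski-open subset of the parameter space. -/
def GenerallyHolds (n m : ℕ) (w : Fin m → ℤ) (a : Fin m → ℕ) (α : ℤ) (β : ℕ)
    (Pred : Cox K n m → Prop) : Prop :=
  ∃ D : MvPolynomial ((Fin n ⊕ Fin m) →₀ ℕ) K,
    (∃ p₀, IsBihom K n m w a α β p₀ ∧ evalCoeff K p₀ D ≠ 0) ∧
    ∀ p, IsBihom K n m w a α β p → evalCoeff K p D ≠ 0 → Pred p

/-- `Pred` holds for a *very general* member of the complete linear system of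
bihomogeneous polynomials of bidegree `(α,β)`: it holds away from countably many
proper Zariski-closed subsets of the parameter space. -/
def VeryGenerallyHolds (n m : ℕ) (w : Fin m → ℤ) (a : Fin m → ℕ) (α : ℤ) (β : ℕ)
    (Pred : Cox K n m → Prop) : Prop :=
  ∃ D : ℕ → MvPolynomial ((Fin n ⊕ Fin m) →₀ ℕ) K,
    (∀ i, ∃ p₀, IsBihom K n m w a α β p₀ ∧ evalCoeff K p₀ (D i) ≠ 0) ∧
    ∀ p, IsBihom K n m w a α β p → (∀ i, evalCoeff K p (D i) ≠ 0) → Pred p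

/-- Evaluation of a polynomial `D` in the coefficients of a quadruple
`(a,b,c,f)` of polynomials in `u_0,…,u_{n-1}`. -/
def evalCoeff4 {n : ℕ} (abcf : Fin 4 → MvPolynomial (Fin n) K)
    (D : MvPolynomial (Fin 4 × (Fin n →₀ ℕ)) K) : K :=
  MvPolynomial.eval (fun q => (abcf q.1).coeff q.2) D

/-- `Pred` holds for a *general* quadruple `(a,b,c,f)` of homogeneous polynomials
in `u_0,…,u_{n-1}` of respective degrees `degs 0, …, degs 3`. -/
def GenerallyHolds4 (n : ℕ) (degs : Fin 4 → ℤ)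
    (Pred : (Fin 4 → MvPolynomial (Fin n) K) → Prop) : Prop :=
  ∃ D : MvPolynomial (Fin 4 × (Fin n →₀ ℕ)) K,
    (∃ abcf : Fin 4 → MvPolynomial (Fin n) K,
      (∀ i, IsHomogZ K n (degs i) (abcf i)) ∧ evalCoeff4 K abcf D ≠ 0) ∧
    ∀ abcf : Fin 4 → MvPolynomial (Fin n) K,
      (∀ i, IsHomogZ K n (degs i) (abcf i)) → evalCoeff4 K abcf D ≠ 0 → Pred abcf

/-! ### Points of the bundle: the punctured affine cone and the torus action -/

/-- A point of the affine cone `𝔸^n × 𝔸^m` over the bundle. -/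
abbrev Pt (n m : ℕ) : Type := (Fin n → K) × (Fin m → K)

/-- Evaluation of a Cox ring element at a point of the affine cone. -/
def evalPt {n m : ℕ} (p : Pt K n m) (f : Cox K n m) : K :=
  MvPolynomial.eval (Sum.elim p.1 p.2) f

/-- Membership in the complement of the irrelevant locus
`V(u_0,…,u_{n-1}) ∪ V(x_0,…,x_{m-1})`. -/
def InCone {n m : ℕ} (p : Pt K n m) : Prop := p.1 ≠ 0 ∧ p.2 ≠ 0

/-- Equivalence of two cone points under the action of the torus `𝔾_m²`:
`(s,t)·(u,x) = (s·u_i, s^{w j} t^{a j}·x_j)`.  The points of the bundle are the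
equivalence classes of points of the punctured cone. -/
def ToricEq {n m : ℕ} (w : Fin m → ℤ) (a : Fin m → ℕ) (p q : Pt K n m) : Prop :=
  ∃ s t : Kˣ, (∀ i, q.1 i = (s : K) * p.1 i) ∧
    (∀ j, q.2 j = ((s ^ (w j) : Kˣ) : K) * (t : K) ^ (a j) * p.2 j)

/-- The punctured affine cone over the member `X = {g = 0}`. -/
def XCone {n m : ℕ} (g : Cox K n m) : Set (Pt K n m) :=
  {p | InCone K p ∧ evalPt K p g = 0}

/-! ### Smoothness via the Jacobian criterion on the cone -/

/-- The hypersurface `{g = 0}` is smooth along (the image of) `S ⊆ 𝔸^n × 𝔸^m`: at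
every point of `S` lying on the cone over `X` some partial derivative of `g` is
nonzero.  On loci where the torus acts freely this is the Jacobian criterion for
smoothness of `X` itself. -/
def JacobiSmoothOn {n m : ℕ} (g : Cox K n m) (S : Set (Pt K n m)) : Prop :=
  ∀ p ∈ S, evalPt K p g = 0 → ∃ v : Fin n ⊕ Fin m, evalPt K p (pderiv v g) ≠ 0

/-- The member `X = {g = 0}` of the linear system is smooth (nonsingular). -/
def IsSmoothModel {n m : ℕ} (g : Cox K n m) : Prop :=
  JacobiSmoothOn K g {p | InCone K p}

/-! ### The function field, rationality, and stable rationality -/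

/-- The homogeneous coordinate ring `Cox/(g)` of the member `X = {g = 0}`,
i.e. the coordinate ring of the affine cone over `X`. -/
abbrev coneRing {n m : ℕ} (g : Cox K n m) : Type :=
  Cox K n m ⧸ Ideal.span {g}

/-- The total fraction ring of the affine cone over `X`; the function field of the
cone when `g` is prime. -/
def FracCone {n m : ℕ} (g : Cox K n m) : Type := FractionRing (coneRing K g)

instance {n m : ℕ} (g : Cox K n m) : CommRing (FracCone K g) :=
  inferInstanceAs (CommRing (FractionRing (coneRing K g)))

instance {n m : ℕ} (g : Cox K n m) : Algebra K (FracCone K g) :=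
  inferInstanceAs (Algebra K (FractionRing (coneRing K g)))

instance {n m : ℕ} (g : Cox K n m) : Algebra (coneRing K g) (FracCone K g) :=
  inferInstanceAs (Algebra (coneRing K g) (FractionRing (coneRing K g)))

/-- The canonical map from the Cox ring to the fraction ring of the cone over `X`. -/
def toFrac {n m : ℕ} (g : Cox K n m) : Cox K n m →+* FracCone K g :=
  (algebraMap (coneRing K g) (FracCone K g)).comp
    (Ideal.Quotient.mk (Ideal.span {g}))

/-- The set of degree-`(0,0)` fractions on the cone over `X`: ratios `p/q` of
bihomogeneous elements of equal bidegree (phrased multiplicatively, avoiding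
inverses). -/
def ratioSet {n m : ℕ} (w : Fin m → ℤ) (a : Fin m → ℕ) (g : Cox K n m) :
    Set (FracCone K g) :=
  {φ | ∃ (α : ℤ) (β : ℕ) (p q : Cox K n m),
    IsBihom K n m w a α β p ∧ IsBihom K n m w a α β q ∧
    toFrac K g q ≠ 0 ∧ φ * toFrac K g q = toFrac K g p}

/-- The `K`-algebra of rational functions on `X = {g = 0}`: the fractions of
degree `(0,0)`.  When `g` is prime this is the function field `K(X)`. -/
def functionFieldModel {n m : ℕ} (w : Fin m → ℤ) (a : Fin m → ℕ) (g : Cox K n m) :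
    Subalgebra K (FracCone K g) :=
  Algebra.adjoin K (ratioSet K w a g)

/-- `X = {g = 0}` is rational: its function field is `K`-isomorphic to a purely
transcendental extension `K(y_1,…,y_N)` of `K`, i.e. `X` is birational to a
projective space. -/
def IsRationalModel {n m : ℕ} (w : Fin m → ℤ) (a : Fin m → ℕ) (g : Cox K n m) :
    Prop :=
  ∃ N : ℕ, Nonempty
    (functionFieldModel K w a g ≃ₐ[K] FractionRing (MvPolynomial (Fin N) K))

/-- `X = {g = 0}` is stably rational: `X × ℙ^r` is birational to a projective
space for some `r`, i.e. `K(X)(x_1,…,x_r) ≅_K K(y_1,…,y_s)` for some `r, s`. -/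
def IsStablyRationalModel {n m : ℕ} (w : Fin m → ℤ) (a : Fin m → ℕ)
    (g : Cox K n m) : Prop :=
  ∃ r s : ℕ, Nonempty
    ((FractionRing (MvPolynomial (Fin r) (functionFieldModel K w a g)))
      ≃ₐ[K] FractionRing (MvPolynomial (Fin s) K))

/-! ### Normality, terminal singularities, class group, ampleness, fibres -/

/-- A prime of the Cox ring is *relevant* if it does not contain either component
of the irrelevant ideal `(u_0,…,u_{n-1}) ∩ (x_0,…,x_{m-1})`. -/
def RelevantPrime {n m : ℕ} (P : Ideal (Cox K n m)) : Prop :=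
  (∃ i, X (Sum.inl i) ∉ P) ∧ (∃ j, X (Sum.inr j) ∉ P)

/-- `X = {g = 0}` is normal: the local rings of the relevant locus of its affine
cone are integrally closed (the punctured cone is a smooth torsor over `X`, so
this is normality of `X`). -/
def IsNormalModel {n m : ℕ} (g : Cox K n m) : Prop :=
  ∀ P : PrimeSpectrum (coneRing K g),
    ((∃ i, Ideal.Quotient.mk (Ideal.span {g}) (X (Sum.inl i)) ∉ P.asIdeal) ∧
     (∃ j, Ideal.Quotient.mk (Ideal.span {g}) (X (Sum.inr j)) ∉ P.asIdeal)) →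
    IsIntegrallyClosed (Localization.AtPrime P.asIdeal)

/-- The singular locus of `X = {g = 0}` has codimension at least `c`: every
relevant prime of the Cox ring containing `g` and all its partial derivatives has
height at least `c + 1` (the height in the cone exceeds the codimension in `X`
by one). -/
def SingularLocusCodimAtLeast {n m : ℕ} (g : Cox K n m) (c : ℕ) : Prop :=
  ∀ P : PrimeSpectrum (Cox K n m), RelevantPrime K P.asIdeal →
    g ∈ P.asIdeal → (∀ v : Fin n ⊕ Fin m, pderiv v g ∈ P.asIdeal) →
    ((c + 1 : ℕ) : WithBot (WithTop ℕ)) ≤ ringKrullDim (Localization.AtPrime P.asIdeal)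

/-- Rendering of "`X` has only terminal singularities" for the members considered
in the paper: `X` is normal and its singular locus has codimension at least 3
(cf. the proof of Lemma 2.8, where the general members with `2m > d > l+m` have
ordinary double points along a nonsingular center of codimension 3). -/
def HasOnlyTerminalSingularitiesModel {n m : ℕ} (g : Cox K n m) : Prop :=
  IsNormalModel K g ∧ SingularLocusCodimAtLeast K g 3

/-- An ideal of the Cox ring is bihomogeneous if it is generated by its
bihomogeneous elements. -/
def IsBihomIdeal {n m : ℕ} (w : Fin m → ℤ) (a : Fin m → ℕ)
    (P : Ideal (Cox K n m)) : Prop :=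
  P ≤ Ideal.span {f | f ∈ P ∧ ∃ α β, IsBihom K n m w a α β f}

/-- A prime divisor of `X = {g = 0}`: a relevant bihomogeneous prime of the Cox
ring containing `g` of height 2 (height 1 over `(g)`). -/
def IsPrimeDivisorOn {n m : ℕ} (w : Fin m → ℤ) (a : Fin m → ℕ) (g : Cox K n m)
    (P : PrimeSpectrum (Cox K n m)) : Prop :=
  g ∈ P.asIdeal ∧ RelevantPrime K P.asIdeal ∧ IsBihomIdeal K w a P.asIdeal ∧
    ringKrullDim (Localization.AtPrime P.asIdeal) = (2 : WithBot (WithTop ℕ))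

/-- Rendering of "`X` is ℚ-factorial with `ρ(X) = 2`", i.e. the divisor class
group of `X` is spanned up to torsion by the pullback `F` of the hyperplane class
and the tautological class `D`: every prime divisor `P` of `X` carries a
bihomogeneous form `f` vanishing on `P` and on no other prime divisor, so that
`div(f) = k·P` for some `k ≥ 1` and hence `[P] ∈ ℚ⟨F,D⟩` in `Cl(X) ⊗ ℚ`. -/
def ClassGroupSpannedByFD {n m : ℕ} (w : Fin m → ℤ) (a : Fin m → ℕ)
    (g : Cox K n m) : Prop :=
  ∀ P : PrimeSpectrum (Cox K n m), IsPrimeDivisorOn K w a g P →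
    ∃ (α : ℤ) (β : ℕ) (f : Cox K n m),
      f ∉ Ideal.span {g} ∧ IsBihom K n m w a α β f ∧ f ∈ P.asIdeal ∧
      ∀ Q : PrimeSpectrum (Cox K n m), IsPrimeDivisorOn K w a g Q → Q ≠ P →
        f ∉ Q.asIdeal

/-- Rendering of "`ρ(X) ≥ 3`": the divisor class group of `X` is not spanned up to
torsion by the fibre class `F` and the tautological class `D`. -/
def PicardRankAtLeastThree {n m : ℕ} (w : Fin m → ℤ) (a : Fin m → ℕ)
    (g : Cox K n m) : Prop :=
  ¬ ClassGroupSpannedByFD K w a g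

/-- The cone over the fibre of `π : X → ℙ^{n-1}` over the point `[u] ∈ ℙ^{n-1}`. -/
def fibreCone {n m : ℕ} (g : Cox K n m) (u : Fin n → K) : Set (Fin m → K) :=
  {v | v ≠ 0 ∧ evalPt K (u, v) g = 0}

/-- The fibres of `π : X → ℙ^{n-1}` are nonempty and connected: no fibre can be
covered by two disjoint nonempty closed subsets, closed subsets of the fibre
being cut out by weighted-homogeneous polynomials in the fibre variables. -/
def FibresNonemptyAndConnected {n m : ℕ} (a : Fin m → ℕ) (g : Cox K n m) : Prop :=
  ∀ u : Fin n → K, u ≠ 0 →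
    (fibreCone K g u).Nonempty ∧
    ∀ A B : Set (MvPolynomial (Fin m) K),
      (∀ q ∈ A ∪ B, ∃ e, IsWHom K m a e q) →
      (∀ v ∈ fibreCone K g u,
        (∀ q ∈ A, MvPolynomial.eval v q = 0) ∨ (∀ q ∈ B, MvPolynomial.eval v q = 0)) →
      (∀ v ∈ fibreCone K g u,
        ¬ ((∀ q ∈ A, MvPolynomial.eval v q = 0) ∧ (∀ q ∈ B, MvPolynomial.eval v q = 0))) →
      ¬ ((∃ v ∈ fibreCone K g u, ∀ q ∈ A, MvPolynomial.eval v q = 0) ∧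
         (∃ v ∈ fibreCone K g u, ∀ q ∈ B, MvPolynomial.eval v q = 0))

/-- The infinitesimal generator of the first torus factor at a cone point. -/
def orbitVec₁ {n m : ℕ} (w : Fin m → ℤ) (p : Pt K n m) : (Fin n ⊕ Fin m) → K :=
  Sum.elim (fun i => p.1 i) (fun j => (w j : K) * p.2 j)

/-- The infinitesimal generator of the second torus factor at a cone point. -/
def orbitVec₂ {n m : ℕ} (a : Fin m → ℕ) (p : Pt K n m) : (Fin n ⊕ Fin m) → K :=
  Sum.elim (fun _ => 0) (fun j => (a j : K) * p.2 j)

/-- The bihomogeneous forms of bidegree `(α,β)` have no base point on `X`. -/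
def BasePointFreeOnX {n m : ℕ} (w : Fin m → ℤ) (a : Fin m → ℕ) (g : Cox K n m)
    (α : ℤ) (β : ℕ) : Prop :=
  ∀ p ∈ XCone K g, ∃ s, IsBihom K n m w a α β s ∧ evalPt K p s ≠ 0

/-- The bihomogeneous forms of bidegree `(α,β)` separate the points of `X`. -/
def SeparatesPointsOnX {n m : ℕ} (w : Fin m → ℤ) (a : Fin m → ℕ) (g : Cox K n m)
    (α : ℤ) (β : ℕ) : Prop :=
  ∀ p ∈ XCone K g, ∀ q ∈ XCone K g, ¬ ToricEq K w a p q →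
    ∃ s₁ s₂, IsBihom K n m w a α β s₁ ∧ IsBihom K n m w a α β s₂ ∧
      evalPt K p s₁ * evalPt K q s₂ ≠ evalPt K q s₁ * evalPt K p s₂

/-- The bihomogeneous forms of bidegree `(α,β)` separate the tangent vectors of
`X`: for every cone point `p` of `X` and every tangent vector `t` of the cone over
`X` at `p` not tangent to the torus orbit, some form vanishing at `p` has nonzero
derivative along `t`. -/
def SeparatesTangentsOnX {n m : ℕ} (w : Fin m → ℤ) (a : Fin m → ℕ) (g : Cox K n m)
    (α : ℤ) (β : ℕ) : Prop :=
  ∀ p ∈ XCone K g, ∀ t : (Fin n ⊕ Fin m) → K,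
    (∑ v : Fin n ⊕ Fin m, t v * evalPt K p (pderiv v g)) = 0 →
    t ∉ Submodule.span K {orbitVec₁ K w p, orbitVec₂ K a p} →
    ∃ s, IsBihom K n m w a α β s ∧ evalPt K p s = 0 ∧
      (∑ v : Fin n ⊕ Fin m, t v * evalPt K p (pderiv v s)) ≠ 0

/-- The class `𝒪_X(α,β)` is ample on `X = {g = 0}`: some positive multiple is very
ample, i.e. its forms are base point free on `X` and separate points and tangent
vectors. -/
def IsAmpleClassOnX {n m : ℕ} (w : Fin m → ℤ) (a : Fin m → ℕ) (g : Cox K n m)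
    (α : ℤ) (β : ℕ) : Prop :=
  ∃ t : ℕ, 0 < t ∧
    BasePointFreeOnX K w a g (t * α) (t * β) ∧
    SeparatesPointsOnX K w a g (t * α) (t * β) ∧
    SeparatesTangentsOnX K w a g (t * α) (t * β)

/-- The canonical class of the ambient bundle `P`, by the toric formula
`K_P = -Σ deg(variables)`. -/
def ambientCanonicalClass (n m : ℕ) (w : Fin m → ℤ) : ℤ × ℤ :=
  (-(n : ℤ) - ∑ j : Fin m, w j, -(m : ℤ))

/-- The anticanonical class `-K_X = -(K_P + X)|_X` of a member `X ∈ |𝒪_P(α,β)|`,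
by adjunction. -/
def memberAntiCanonicalClass (n m : ℕ) (w : Fin m → ℤ) (α : ℤ) (β : ℕ) : ℤ × ℤ :=
  (-((ambientCanonicalClass n m w).1 + α), -((ambientCanonicalClass n m w).2 + β))

/-- `-K_X` is `π`-ample for the projection `π : X → ℙ^{n-1}`: some twist of `-K_X`
by the pullback of a (sufficiently ample) divisor on the base is ample. -/
def AntiCanonicalIsRelativelyAmple {n m : ℕ} (w : Fin m → ℤ) (a : Fin m → ℕ)
    (g : Cox K n m) (α : ℤ) (β : ℕ) : Prop :=
  ∃ N : ℤ,
    IsAmpleClassOnX K w a g ((memberAntiCanonicalClass n m w α β).1 + N)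
      (memberAntiCanonicalClass n m w α β).2.toNat

/-- Rendering of Definition 2.5 of the paper: the projection
`π : X → ℙ^{n-1}` of the member `X = {g = 0} ∈ |𝒪_P(d,2)|` of the `ℙ²`-bundle
`P = P_n(w 0, w 1, w 2)` over `ℙ^{n-1}` is a *conic bundle*, i.e. a Mori fibre
space of relative dimension one: `X` is an (irreducible, normal, projective)
variety with only terminal singularities, `π` has connected fibres, `-K_X` is
`π`-ample, and `X` is ℚ-factorial of Picard rank `ρ(X) = 2`.  (Being embedded in
`|𝒪_P(d,2)|` of a projectivized split rank-3 bundle, this is an *embedded* conic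
bundle in the sense of Definition 2.6.) -/
structure IsConicBundleModel (n : ℕ) (w : Fin 3 → ℤ) (d : ℤ) (g : Cox K n 3) :
    Prop where
  bihom : IsBihom K n 3 w (fun _ => 1) d 2 g
  integral : (Ideal.span {g} : Ideal (Cox K n 3)).IsPrime
  normal : IsNormalModel K g
  terminal : HasOnlyTerminalSingularitiesModel K g
  connectedFibres : FibresNonemptyAndConnected K (fun _ => 1) g
  antiCanonicalRelAmple :
    AntiCanonicalIsRelativelyAmple K w (fun _ => 1) g d 2
  picardRankTwo : ClassGroupSpannedByFD K w (fun _ => 1) g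

/-! ### The discriminant of a conic bundle -/

/-- The coefficient of the monomial `x^e` (in the fibre variables) of `g`, as a
polynomial on the base. -/
def fibreCoeff {n m : ℕ} (g : Cox K n m) (e : Fin m →₀ ℕ) :
    MvPolynomial (Fin n) K :=
  ((MvPolynomial.sumAlgEquiv K (Fin m) (Fin n))
    (MvPolynomial.rename Sum.swap g)).coeff e

/-- The symmetric matrix of the fibrewise quadratic form of a member
`X = {g = 0} ∈ |𝒪_P(d,2)|` (over a field of characteristic zero). -/
def quadraticMatrix {n : ℕ} (g : Cox K n 3) :
    Matrix (Fin 3) (Fin 3) (MvPolynomial (Fin n) K) :=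
  fun i j =>
    if i = j then fibreCoeff K g (Finsupp.single i 2)
    else MvPolynomial.C ((2 : K)⁻¹) *
      fibreCoeff K g (Finsupp.single i 1 + Finsupp.single j 1)

/-- The equation of the discriminant divisor `Δ ⊂ ℙ^{n-1}` of the conic bundle
`π : X → ℙ^{n-1}`, `X = {g = 0}`: the determinant of the associated symmetric
matrix. -/
def discriminantPoly {n : ℕ} (g : Cox K n 3) : MvPolynomial (Fin n) K :=
  (quadraticMatrix K g).det

/-- The complete linear system `|k·K_{ℙ^{n-1}} + Δ|` is nonempty, where `Δ` is the
discriminant divisor of the conic bundle `X = {g = 0}`: the divisor class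
`𝒪(deg Δ - k·n)` on `ℙ^{n-1}` contains an effective divisor. -/
def KMultipleplusDiscriminantEffective {n : ℕ} (g : Cox K n 3) (k : ℕ) : Prop :=
  discriminantPoly K g ≠ 0 ∧
    ∃ h : MvPolynomial (Fin n) K, h ≠ 0 ∧
      IsHomogZ K n (((discriminantPoly K g).totalDegree : ℤ) - k * n) h

/-- `π : X → ℙ^{n-1}` is flat, i.e. no fibre is two-dimensional: `g` does not
vanish identically on any fibre of the ambient bundle.  Together with smoothness
of `X` this renders a *standard* conic bundle. -/
def ProjectionIsFlat {n m : ℕ} (g : Cox K n m) : Prop :=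
  ∀ u : Fin n → K, u ≠ 0 → ∃ v : Fin m → K, evalPt K (u, v) g ≠ 0

end

end ConicBundleFormalization

namespace ConicBundleFormalization

noncomputable section

variable (K : Type) [Field K]

/-! ### The special members `a x² + b y² + c z² + f x y` and the associated double
cover data in characteristic 2 -/

/-- The special member `X = {a x² + b y² + c z² + f x y = 0}` of
`|𝒪_P(λ+μ+ν, 2)|`, `P = P_n(λ,μ,ν)`, built from a quadruple `(a,b,c,f)` of
polynomials on the base (equation (3.1) of the paper). -/
def specialMemberX {n : ℕ} (abcf : Fin 4 → MvPolynomial (Fin n) K) : Cox K n 3 :=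
  rename Sum.inl (abcf 0) * X (Sum.inr 0) ^ 2 +
  rename Sum.inl (abcf 1) * X (Sum.inr 1) ^ 2 +
  rename Sum.inl (abcf 2) * X (Sum.inr 2) ^ 2 +
  rename Sum.inl (abcf 3) * X (Sum.inr 0) * X (Sum.inr 1)

/-- The hypersurface `Z = {a x² + b y² + c z̄ + f x y = 0}` in the
`ℙ(1,1,2)`-bundle `R` over `ℙ^{n-1}` (with `z̄` the third fibre variable, of
weight 2), the image of `X` under the purely inseparable double cover `P → R` in
characteristic 2. -/
def specialMemberZ {n : ℕ} (abcf : Fin 4 → MvPolynomial (Fin n) K) : Cox K n 3 :=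
  rename Sum.inl (abcf 0) * X (Sum.inr 0) ^ 2 +
  rename Sum.inl (abcf 1) * X (Sum.inr 1) ^ 2 +
  rename Sum.inl (abcf 2) * X (Sum.inr 2) +
  rename Sum.inl (abcf 3) * X (Sum.inr 0) * X (Sum.inr 1)

/-! ### Admissible critical points (Definition 3.5 of the paper) -/

/-- A polynomial `F` in `N` variables over a field of characteristic 2 is in
*admissible normal form* at the origin: its linear part vanishes (a critical
point) and, up to an additive constant and higher-order terms,
`F = α + x₀x₁ + x₂x₃ + ⋯ + x_{N-2}x_{N-1}` if `N` is even, and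
`F = α + βx₀² + x₁x₂ + ⋯ + x_{N-2}x_{N-1} + (nonzero)·x₀³ + ⋯` if `N` is odd. -/
def AdmissibleNormalForm {N : ℕ} (F : MvPolynomial (Fin N) K) : Prop :=
  (∀ i, F.coeff (Finsupp.single i 1) = 0) ∧
  (N % 2 = 0 →
    (∀ i, F.coeff (Finsupp.single i 2) = 0) ∧
    (∀ i j : Fin N, (i : ℕ) < (j : ℕ) →
      F.coeff (Finsupp.single i 1 + Finsupp.single j 1) =
        (if (i : ℕ) % 2 = 0 ∧ (j : ℕ) = (i : ℕ) + 1 then 1 else 0))) ∧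
  (N % 2 = 1 →
    (∀ i : Fin N, (i : ℕ) ≠ 0 → F.coeff (Finsupp.single i 2) = 0) ∧
    (∀ i j : Fin N, (i : ℕ) < (j : ℕ) →
      F.coeff (Finsupp.single i 1 + Finsupp.single j 1) =
        (if (i : ℕ) % 2 = 1 ∧ (j : ℕ) = (i : ℕ) + 1 then 1 else 0)) ∧
    (∀ h0 : 0 < N, F.coeff (Finsupp.single (⟨0, h0⟩ : Fin N) 3) ≠ 0))

/-- A local function `F` (a polynomial in the local coordinates indexed by `ι`,
centred at the origin) has an *admissible critical point* at the origin: after a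
suitable (linear) change of coordinates it is in admissible normal form. -/
def AdmissibleLocalFunction {ι : Type} [Fintype ι] (F : MvPolynomial ι K) : Prop :=
  ∃ (N : ℕ) (e : ι ≃ Fin N) (T : Matrix (Fin N) (Fin N) K), IsUnit T.det ∧
    AdmissibleNormalForm K
      ((aeval (fun i : ι => ∑ j : Fin N, MvPolynomial.C (T (e i) j) * X j)) F)

/-- The local expression of the section `z̄` of `𝓛²` on the chart `x = 1` of `Z`
(multiplied by the square unit `c̃²`, i.e. computed with respect to the local
generator `c̃·ξ` of `𝓛`): the polynomial `c·(a + b·y² + f·y)` in the base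
variables and the remaining fibre variable `y`. -/
def chartPolyX {n : ℕ} (abcf : Fin 4 → MvPolynomial (Fin n) K) :
    MvPolynomial (Fin n ⊕ Fin 1) K :=
  rename Sum.inl (abcf 2) *
    (rename Sum.inl (abcf 0) + rename Sum.inl (abcf 1) * X (Sum.inr 0) ^ 2 +
      rename Sum.inl (abcf 3) * X (Sum.inr 0))

/-- The local expression of the section `z̄` on the chart `y = 1` of `Z`:
the polynomial `c·(a·x² + b + f·x)`. -/
def chartPolyY {n : ℕ} (abcf : Fin 4 → MvPolynomial (Fin n) K) :
    MvPolynomial (Fin n ⊕ Fin 1) K :=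
  rename Sum.inl (abcf 2) *
    (rename Sum.inl (abcf 0) * X (Sum.inr 0) ^ 2 + rename Sum.inl (abcf 1) +
      rename Sum.inl (abcf 3) * X (Sum.inr 0))

/-- Translation of a chart polynomial to local coordinates centred at the point
with base coordinates `u0` (normalized by `u0 i0 = 1`) and fibre coordinate `y0`:
substitute `u_{i0} ↦ 1`, `u_j ↦ u_j + u0 j` and `y ↦ y + y0`.  The variables are
the genuine local coordinates `{u_j : j ≠ i0} ∪ {y}` of `Z` at that point. -/
def localAt {n : ℕ} (i0 : Fin n) (u0 : Fin n → K) (y0 : K)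
    (G : MvPolynomial (Fin n ⊕ Fin 1) K) :
    MvPolynomial ({ j : Fin n // j ≠ i0 } ⊕ Fin 1) K :=
  aeval (Sum.elim
    (fun j => if h : j = i0 then 1 else X (Sum.inl ⟨j, h⟩) + MvPolynomial.C (u0 j))
    (fun _ => X (Sum.inr 0) + MvPolynomial.C y0)) G

/-- The section `z̄` of `𝓛²` on `Z = {gZ = 0}` has a *critical point* at the point
below the normalized cone point `p` (with `u_{i0} = 1` and the fibre coordinate
`jfix ∈ {x, y}` normalized to 1): the differential of `z̄` vanishes on the tangent
space of `Z` at that point, i.e. every chart tangent vector `t` of `Z` has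
vanishing `z̄`-component. -/
def CriticalPointOfZbar {n : ℕ} (gZ : Cox K n 3) (i0 : Fin n) (jfix : Fin 3)
    (p : Pt K n 3) : Prop :=
  ∀ t : (Fin n ⊕ Fin 3) → K, t (Sum.inl i0) = 0 → t (Sum.inr jfix) = 0 →
    (∑ v : Fin n ⊕ Fin 3, t v * evalPt K p (pderiv v gZ)) = 0 →
    t (Sum.inr 2) = 0

/-- `p` is a singular point of the cone over `X = {g = 0}`. -/
def SingularConePoint {n m : ℕ} (g : Cox K n m) (p : Pt K n m) : Prop :=
  p ∈ XCone K g ∧ ∀ v : Fin n ⊕ Fin m, evalPt K p (pderiv v g) = 0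

end

end ConicBundleFormalization

namespace ConicBundleFormalization

open MvPolynomial

section
theorem exists_dep {K : Type} [Field K] {σ κ : Type} [Fintype σ] [Fintype κ]
    (hc : Fintype.card κ < Fintype.card σ) (Q : σ → MvPolynomial κ K) :
    ∃ D : MvPolynomial σ K, D ≠ 0 ∧ ∀ x : κ → K, eval (fun c => eval x (Q c)) D = 0 := by
  have h : ¬ AlgebraicIndependent K Q := by
    intro h
    have h1 := h.cardinalMk_le_trdeg
    rw [MvPolynomial.trdeg_of_isDomain] at h1
    simp at h1
    omega
  rw [algebraicIndependent_iff] at h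
  push Not at h
  obtain ⟨D, hD, hne⟩ := h
  refine ⟨D, hne, fun x => ?_⟩
  have h2 := congrArg (eval x) hD
  rw [map_zero] at h2
  rw [← h2, aeval_def, ← coe_eval₂Hom]
  change _ = ((eval x).comp _) D
  rw [comp_eval₂Hom]
  simp only [eval, coe_eval₂Hom]
  congr 1
  ext r
  simp [algebraMap_eq]

theorem exists_minor {K : Type} [Field K] {σ ρ : Type} [Fintype σ] [Fintype ρ] [DecidableEq ρ]
    (A : Matrix ρ σ K) (hA : ∀ t : ρ → K, ∃ q : σ → K, A.mulVec q = t) :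
    ∃ J : ρ → σ, Function.Injective J ∧ (A.submatrix id J).det ≠ 0 := by
  obtain ⟨κ, a, ha, hs, hl⟩ := exists_linearIndependent' K A.col
  have htop : Submodule.span K (Set.range (A.col ∘ a)) = ⊤ := by
    rw [hs, ← Matrix.range_mulVecLin]
    rw [LinearMap.range_eq_top]
    intro t
    exact hA t
  let b := Module.Basis.mk hl htop.ge
  have : Fintype κ := Fintype.ofInjective a ha
  have e : ρ ≃ κ := (Pi.basisFun K ρ).indexEquiv b
  refine ⟨a ∘ e, ha.comp e.injective, ?_⟩
  have h2 : LinearIndependent K (A.submatrix id (a ∘ e)).col := by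
    have := hl.comp e e.injective
    exact this
  rw [Matrix.linearIndependent_cols_iff_isUnit, Matrix.isUnit_iff_isUnit_det] at h2
  exact h2.ne_zero

theorem exists_disc {K : Type} [Field K] {σ ρ τ : Type} [Fintype σ] [Fintype ρ] [Fintype τ]
    [DecidableEq ρ] [DecidableEq σ]
    (hc : Fintype.card τ < Fintype.card ρ) (M : Matrix ρ σ (MvPolynomial τ K)) :
    ∃ D : MvPolynomial σ K, D ≠ 0 ∧ ∀ (p : σ → K) (w : τ → K),
      (M.map (eval w)).mulVec p = 0 →
      (∀ t : ρ → K, ∃ q : σ → K, (M.map (eval w)).mulVec q = t) → eval p D = 0 := by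
  classical
  have key : ∀ J : ρ → σ, ∃ D : MvPolynomial σ K, D ≠ 0 ∧ ∀ (p : σ → K) (w : τ → K),
      (M.map (eval w)).mulVec p = 0 → Function.Injective J →
      ((M.map (eval w)).submatrix id J).det ≠ 0 → eval p D = 0 := by
    intro J
    by_cases hJ : Function.Injective J
    swap
    · exact ⟨1, one_ne_zero, fun p w _ h => absurd h hJ⟩
    let κ := τ ⊕ {c : σ // c ∉ Set.range J}
    let A' : Matrix ρ σ (MvPolynomial κ K) := M.map (rename Sum.inl)
    let AJ := A'.submatrix id J
    let qv : σ → MvPolynomial κ K := fun c => if h : c ∉ Set.range J then X (Sum.inr ⟨c, h⟩) else 0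
    let Q : σ → MvPolynomial κ K := fun c =>
      AJ.det * qv c - ∑ r, if J r = c then (AJ.adjugate.mulVec (A'.mulVec qv)) r else 0
    have hcard : Fintype.card κ < Fintype.card σ := by
      have h1 : Fintype.card {c : σ // c ∉ Set.range J} = Fintype.card σ - Fintype.card ρ := by
        rw [Fintype.card_subtype_compl]
        congr 1
        exact Set.card_range_of_injective hJ
      have h2 := Fintype.card_le_of_injective J hJ
      simp only [κ, Fintype.card_sum]
      omega
    obtain ⟨D, hD, hz⟩ := exists_dep hcard Q
    refine ⟨D, hD, fun p w hp _ hdet => ?_⟩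
    set A := M.map (eval w) with hA
    set d := (A.submatrix id J).det with hd
    let x : κ → K := Sum.elim w (fun c => p c / d)
    let q : σ → K := fun c => if c ∉ Set.range J then p c / d else 0
    have e1 : A'.map (eval x) = A := by
      ext r c
      simp only [A', A, Matrix.map_apply, eval_rename]
      rfl
    have e1' : AJ.map (eval x) = A.submatrix id J := by
      rw [← e1]; rfl
    have e2 : ∀ c, eval x (qv c) = q c := by
      intro c
      simp only [qv, q]
      split_ifs with h
      · simp
      · rw [eval_X]; rfl
    have e3 : eval x AJ.det = d := by
      rw [RingHom.map_det, RingHom.mapMatrix_apply, e1']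
    have e4 : ∀ r, eval x ((AJ.adjugate.mulVec (A'.mulVec qv)) r) =
        ((A.submatrix id J).adjugate.mulVec (A.mulVec q)) r := by
      intro r
      rw [RingHom.map_mulVec, ← e1', ← RingHom.mapMatrix_apply, RingHom.map_adjugate,
        RingHom.mapMatrix_apply]
      have h5 : (eval x) ∘ qv = q := funext e2
      have h6 : (eval x) ∘ (A'.mulVec qv) = A.mulVec q := by
        funext r'
        simp only [Function.comp]
        rw [RingHom.map_mulVec, e1, h5]
      rw [h6]
    have hp2 : ∀ r, d * (A.mulVec q) r + ((A.submatrix id J).mulVec (p ∘ J)) r = 0 := by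
      intro r
      rw [show (0:K) = A.mulVec p r from (congrFun hp r).symm]
      simp only [Matrix.mulVec, dotProduct, Matrix.submatrix_apply, id, Function.comp]
      rw [Finset.mul_sum]
      have : ∑ i, A r (J i) * p (J i) = ∑ c, if c ∈ Set.range J then A r c * p c else 0 := by
        rw [← Finset.sum_filter]
        rw [← Finset.sum_image (g := J) (f := fun c => A r c * p c) (s := Finset.univ)
          (fun a _ b _ h => hJ h)]
        congr 1
        ext c
        simp
      rw [this, ← Finset.sum_add_distrib]
      refine Finset.sum_congr rfl fun c _ => ?_
      simp only [q]
      by_cases h : c ∈ Set.range J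
      · simp [h]
      · simp only [h, not_false_eq_true, if_true, if_false]
        field_simp
        simp
    have hp3 : ∀ r, p (J r) = - ((A.submatrix id J).adjugate.mulVec (A.mulVec q)) r := by
      have h1 : d • A.mulVec q + (A.submatrix id J).mulVec (p ∘ J) = 0 := by
        ext r; simpa using hp2 r
      have h2 := congrArg ((A.submatrix id J).adjugate.mulVec) h1
      rw [Matrix.mulVec_add, Matrix.mulVec_smul, Matrix.mulVec_mulVec (p ∘ J), Matrix.adjugate_mul,
        Matrix.smul_mulVec, Matrix.one_mulVec, ← smul_add, Matrix.mulVec_zero] at h2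
      have h3 := (smul_eq_zero.mp h2).resolve_left hdet
      intro r
      have h4 := congrFun h3 r
      simp only [Pi.add_apply, Function.comp, Pi.zero_apply] at h4
      linear_combination h4
    have hfin : (fun c => eval x (Q c)) = p := by
      ext c
      simp only [Q, map_sub, map_mul, map_sum, e2, e3, apply_ite (eval x), e4, map_zero]
      by_cases h : c ∈ Set.range J
      · obtain ⟨r, rfl⟩ := h
        simp only [hJ.eq_iff, Finset.sum_ite_eq', Finset.mem_univ, if_true]
        rw [hp3 r]
        simp [q]
      · have : ∀ r, J r ≠ c := fun r hr => h ⟨r, hr⟩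
        simp only [this, if_false, Finset.sum_const_zero, q, h, not_false_eq_true, if_true]
        field_simp
        simp
    have := hz x
    rwa [hfin] at this
  choose D hD hz using key
  refine ⟨∏ J, D J, Finset.prod_ne_zero_iff.mpr fun J _ => hD J, fun p w h1 h2 => ?_⟩
  obtain ⟨J, hJ, hdet⟩ := exists_minor _ h2
  rw [map_prod]
  exact Finset.prod_eq_zero (Finset.mem_univ J) (hz J p w h1 hJ hdet)

end

section
/-! linear algebra -/

theorem exists_hyp_pair {K : Type} [Field K] [IsAlgClosed K] [CharP K 2] {V : Type}
    [AddCommGroup V] [Module K V] (q : QuadraticForm K V) (w w' : V)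
    (h : QuadraticMap.polar q w w' ≠ 0) :
    ∃ e f : V, e ∈ Submodule.span K {w, w'} ∧ f ∈ Submodule.span K {w, w'} ∧
      q e = 0 ∧ q f = 0 ∧ QuadraticMap.polar q e f = 1 := by
  have h2 : (2 : K) = 0 := CharTwo.two_eq_zero
  have hself : ∀ x, QuadraticMap.polar q x x = 0 := by
    intro x
    rw [QuadraticMap.polar_self, two_smul, CharTwo.add_self_eq_zero]
  have hw : w ∈ Submodule.span K {w, w'} := Submodule.subset_span (by simp)
  have hw' : w' ∈ Submodule.span K {w, w'} := Submodule.subset_span (by simp)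
  -- isotropic vector
  have step : ∃ e g : V, e ∈ Submodule.span K {w, w'} ∧ g ∈ Submodule.span K {w, w'} ∧
      q e = 0 ∧ QuadraticMap.polar q e g ≠ 0 := by
    by_cases h0 : q w' = 0
    · exact ⟨w', w, hw', hw, h0, by rwa [QuadraticMap.polar_comm]⟩
    · have hdeg : (Polynomial.C (q w') * Polynomial.X ^ 2 +
          Polynomial.C (QuadraticMap.polar q w w') * Polynomial.X + Polynomial.C (q w)).degree ≠ 0 := by
        rw [Polynomial.degree_quadratic h0]; decide
      obtain ⟨s, hs⟩ := IsAlgClosed.exists_root _ hdeg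
      simp only [Polynomial.IsRoot.def, Polynomial.eval_add, Polynomial.eval_mul,
        Polynomial.eval_C, Polynomial.eval_pow, Polynomial.eval_X] at hs
      refine ⟨w + s • w', w', Submodule.add_mem _ hw (Submodule.smul_mem _ _ hw'), hw', ?_, ?_⟩
      · rw [QuadraticMap.map_add q, QuadraticMap.map_smul, QuadraticMap.polar_smul_right]
        simp only [smul_eq_mul]
        linear_combination hs
      · rw [QuadraticMap.polar_add_left, QuadraticMap.polar_smul_left, hself]
        simpa using h
  obtain ⟨e, g, he, hg, hqe, heg⟩ := step
  set c := QuadraticMap.polar q e g with hc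
  refine ⟨e, c⁻¹ • g + (c⁻¹ * c⁻¹ * q g) • e, he, Submodule.add_mem _ (Submodule.smul_mem _ _ hg)
    (Submodule.smul_mem _ _ he), hqe, ?_, ?_⟩
  · rw [QuadraticMap.map_add q, QuadraticMap.map_smul, QuadraticMap.map_smul,
      QuadraticMap.polar_smul_right, QuadraticMap.polar_smul_left, QuadraticMap.polar_comm, ← hc, hqe]
    simp only [smul_eq_mul]
    field_simp
    linear_combination (q g) * c ^ 2 * h2
  · rw [QuadraticMap.polar_add_right, QuadraticMap.polar_smul_right, QuadraticMap.polar_smul_right,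
      hself, ← hc]
    simp [heg]

structure Hyp {K : Type} [Field K] {V : Type} [AddCommGroup V] [Module K V]
    (q : QuadraticForm K V) (r : ℕ) (g : ℕ → V) : Prop where
  iso : ∀ i < 2 * r, q (g i) = 0
  pair : ∀ i < 2 * r, ∀ j < 2 * r, QuadraticMap.polar q (g i) (g j) =
    if i / 2 = j / 2 ∧ i ≠ j then 1 else 0
  compl : ∀ w, ∃ w', w - w' ∈ Submodule.span K (g '' {i | i < 2 * r}) ∧
    ∀ i < 2 * r, QuadraticMap.polar q w' (g i) = 0

theorem Hyp.step {K : Type} [Field K] [IsAlgClosed K] [CharP K 2] {V : Type}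
    [AddCommGroup V] [Module K V] {q : QuadraticForm K V} {r : ℕ} {g : ℕ → V} (H : Hyp q r g)
    (w w' : V) (hw : ∀ i < 2 * r, QuadraticMap.polar q w (g i) = 0)
    (hw' : ∀ i < 2 * r, QuadraticMap.polar q w' (g i) = 0)
    (h : QuadraticMap.polar q w w' ≠ 0) : ∃ g', Hyp q (r + 1) g' := by
  have h2 : (2 : K) = 0 := CharTwo.two_eq_zero
  have hself : ∀ x, QuadraticMap.polar q x x = 0 := by
    intro x
    rw [QuadraticMap.polar_self, two_smul, CharTwo.add_self_eq_zero]
  obtain ⟨e, f, he, hf, hqe, hqf, hef⟩ := exists_hyp_pair q w w' h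
  have horth : ∀ x ∈ Submodule.span K {w, w'}, ∀ i < 2 * r, QuadraticMap.polar q x (g i) = 0 := by
    intro x hx i hi
    obtain ⟨a, b, rfl⟩ := Submodule.mem_span_pair.mp hx
    rw [QuadraticMap.polar_add_left, QuadraticMap.polar_smul_left, QuadraticMap.polar_smul_left,
      hw i hi, hw' i hi]
    simp
  have he' := horth e he
  have hf' := horth f hf
  have hfe : QuadraticMap.polar q f e = 1 := by rw [QuadraticMap.polar_comm, hef]
  have he'' : ∀ i < 2 * r, QuadraticMap.polar q (g i) e = 0 := fun i hi => by
    rw [QuadraticMap.polar_comm, he' i hi]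
  have hf'' : ∀ i < 2 * r, QuadraticMap.polar q (g i) f = 0 := fun i hi => by
    rw [QuadraticMap.polar_comm, hf' i hi]
  let g' : ℕ → V := fun i => if i < 2 * r then g i else if i = 2 * r then e else f
  have g1 : ∀ i < 2 * r, g' i = g i := fun i hi => by simp [g', hi]
  have g2 : g' (2 * r) = e := by simp [g']
  have g3 : g' (2 * r + 1) = f := by simp [g']
  have cases3 : ∀ i < 2 * (r + 1), i < 2 * r ∨ i = 2 * r ∨ i = 2 * r + 1 := by intro i hi; omega
  refine ⟨g', ?_, ?_, ?_⟩
  · intro i hi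
    rcases cases3 i hi with h | rfl | rfl
    · rw [g1 i h]; exact H.iso i h
    · rw [g2, hqe]
    · rw [g3, hqf]
  · intro i hi j hj
    rcases cases3 i hi with h | rfl | rfl <;> rcases cases3 j hj with h' | rfl | rfl
    · rw [g1 i h, g1 j h']; exact H.pair i h j h'
    · rw [g1 i h, g2, he'' i h, if_neg (by omega)]
    · rw [g1 i h, g3, hf'' i h, if_neg (by omega)]
    · rw [g1 j h', g2, he' j h', if_neg (by omega)]
    · rw [g2, hself, if_neg (by omega)]
    · rw [g2, g3, hef, if_pos (by omega)]
    · rw [g1 j h', g3, hf' j h', if_neg (by omega)]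
    · rw [g2, g3, hfe, if_pos (by omega)]
    · rw [g3, hself, if_neg (by omega)]
  · intro x
    obtain ⟨y, hy, hy'⟩ := H.compl x
    refine ⟨y - QuadraticMap.polar q y f • e - QuadraticMap.polar q y e • f, ?_, ?_⟩
    · have hsub : Submodule.span K (g '' {i | i < 2 * r}) ≤
          Submodule.span K (g' '' {i | i < 2 * (r + 1)}) := by
        apply Submodule.span_mono
        rintro _ ⟨i, hi, rfl⟩
        simp only [Set.mem_ofPred_eq] at hi
        exact ⟨i, by simp only [Set.mem_ofPred_eq]; omega, g1 i hi⟩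
      have m1 : e ∈ Submodule.span K (g' '' {i | i < 2 * (r + 1)}) :=
        Submodule.subset_span ⟨2 * r, by simp only [Set.mem_ofPred_eq]; omega, g2⟩
      have m2 : f ∈ Submodule.span K (g' '' {i | i < 2 * (r + 1)}) :=
        Submodule.subset_span ⟨2 * r + 1, by simp only [Set.mem_ofPred_eq]; omega, g3⟩
      have : x - (y - QuadraticMap.polar q y f • e - QuadraticMap.polar q y e • f) =
        (x - y) + QuadraticMap.polar q y f • e + QuadraticMap.polar q y e • f := by abel
      rw [this]
      exact Submodule.add_mem _ (Submodule.add_mem _ (hsub hy) (Submodule.smul_mem _ _ m1))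
        (Submodule.smul_mem _ _ m2)
    · intro i hi
      rw [QuadraticMap.polar_sub_left, QuadraticMap.polar_sub_left, QuadraticMap.polar_smul_left,
        QuadraticMap.polar_smul_left]
      rcases cases3 i hi with h | rfl | rfl
      · rw [g1 i h, hy' i h, he' i h, hf' i h]; simp
      · rw [g2, hself, hfe]; simp
      · rw [g3, hself, hef]; simp

theorem Hyp.coeff_zero {K : Type} [Field K] {V : Type}
    [AddCommGroup V] [Module K V] {q : QuadraticForm K V} {r : ℕ} {g : ℕ → V} (H : Hyp q r g)
    (v : V) (hv : ∀ w, QuadraticMap.polar q v w = 0) (a : Fin (2 * r) → K)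
    (h : v + ∑ i, a i • g i = 0) (i : Fin (2 * r)) : a i = 0 := by
  let j : ℕ := if (i : ℕ) % 2 = 0 then i + 1 else i - 1
  have hj : j < 2 * r := by have := i.2; simp only [j]; split_ifs <;> omega
  have h1 : q.polarBilin (v + ∑ i, a i • g i) (g j) = 0 := by rw [h]; simp
  rw [map_add, map_sum, LinearMap.add_apply, LinearMap.sum_apply] at h1
  simp only [map_smul, LinearMap.smul_apply, QuadraticMap.polarBilin_apply_apply, hv, zero_add] at h1
  rw [Finset.sum_eq_single i] at h1
  · rw [H.pair i i.2 j hj, if_pos (by simp only [j]; split_ifs <;> omega)] at h1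
    simpa using h1
  · intro k _ hk
    have : (k : ℕ) ≠ i := fun h => hk (Fin.ext h)
    rw [H.pair k k.2 j hj, if_neg (by simp only [j]; split_ifs <;> omega)]
    simp
  · simp

theorem exists_hyp {K : Type} [Field K] [IsAlgClosed K] [CharP K 2] {V : Type}
    [AddCommGroup V] [Module K V] [FiniteDimensional K V] (q : QuadraticForm K V) :
    ∃ r g, Hyp q r g ∧ ∀ w, (∀ i < 2 * r, QuadraticMap.polar q w (g i) = 0) →
      ∀ w', QuadraticMap.polar q w w' = 0 := by
  by_contra hcon
  push Not at hcon
  have all : ∀ r, ∃ g, Hyp q r g := by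
    intro r
    induction r with
    | zero => exact ⟨0, by simp, by simp, fun w => ⟨w, by simp⟩⟩
    | succ r ih =>
      obtain ⟨g, H⟩ := ih
      obtain ⟨w, hw, w', hne⟩ := hcon r g H
      obtain ⟨y, hy, hy'⟩ := H.compl w'
      refine H.step w y hw hy' ?_
      intro h0
      apply hne
      have hz : ∀ x ∈ Submodule.span K (g '' {i | i < 2 * r}), q.polarBilin w x = 0 := by
        intro x hx
        induction hx using Submodule.span_induction with
        | mem x hx => obtain ⟨i, hi, rfl⟩ := hx; exact hw i hi
        | zero => simp
        | add x y _ _ hx hy => simp only [map_add, hx, hy, add_zero]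
        | smul a x _ hx => simp only [map_smul, hx, smul_zero]
      have := hz _ hy
      rw [map_sub] at this
      simp only [QuadraticMap.polarBilin_apply_apply, h0, sub_zero] at this
      exact this
  obtain ⟨g, H⟩ := all (Module.finrank K V + 1)
  have hl : LinearIndependent K (fun i : Fin (2 * (Module.finrank K V + 1)) => g i) := by
    rw [Fintype.linearIndependent_iff]
    intro a ha i
    exact H.coeff_zero 0 (by simp) a (by simpa using ha) i
  have := hl.fintype_card_le_finrank
  simp at this
  omega

end

section
noncomputable def lineP {K : Type} [Field K] {ι : Type} (F : MvPolynomial ι K) (v : ι → K) :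
    Polynomial K :=
  aeval (fun i => Polynomial.C (v i) * Polynomial.X) F

section
variable {K : Type} [Field K] {ι : Type}

theorem lineP_mul_X (F : MvPolynomial ι K) (v : ι → K) (i : ι) :
    lineP (F * X i) v = lineP F v * Polynomial.C (v i) * Polynomial.X := by
  simp [lineP, mul_assoc]

theorem lineP_coeff_zero (F : MvPolynomial ι K) (v : ι → K) :
    (lineP F v).coeff 0 = F.coeff 0 := by
  induction F using MvPolynomial.induction_on with
  | C a => simp [lineP]
  | add p q hp hq => simp only [lineP, map_add, Polynomial.coeff_add, coeff_add] at *; rw [hp, hq]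
  | mul_X p i hp =>
    classical
    rw [lineP_mul_X, coeff_mul_X']
    simp

theorem lineP_quad [Finite ι] (F : MvPolynomial ι K) :
    ∃ (l : (ι → K) →ₗ[K] K) (q : QuadraticForm K (ι → K)),
      ∀ v, (lineP F v).coeff 1 = l v ∧ (lineP F v).coeff 2 = q v := by
  induction F using MvPolynomial.induction_on with
  | C a => exact ⟨0, 0, fun v => by simp [lineP, Polynomial.coeff_C]⟩
  | add p q hp hq =>
    obtain ⟨l, Q, h⟩ := hp
    obtain ⟨l', Q', h'⟩ := hq
    refine ⟨l + l', Q + Q', fun v => ?_⟩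
    have e : lineP (p + q) v = lineP p v + lineP q v := by simp [lineP]
    rw [e]
    simp [h v, h' v]
  | mul_X p i hp =>
    obtain ⟨l, Q, h⟩ := hp
    refine ⟨p.coeff 0 • LinearMap.proj i, QuadraticMap.linMulLin l (LinearMap.proj i), fun v => ?_⟩
    rw [lineP_mul_X]
    constructor
    · rw [Polynomial.coeff_mul_X, Polynomial.coeff_mul_C, lineP_coeff_zero]
      simp
    · rw [Polynomial.coeff_mul_X, Polynomial.coeff_mul_C, (h v).1]
      simp

theorem lineP_single [DecidableEq ι] (F : MvPolynomial ι K) (j : ι) (m : ℕ) :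
    (lineP F (Pi.single j 1)).coeff m = F.coeff (Finsupp.single j m) := by
  induction F using MvPolynomial.induction_on generalizing m with
  | C a =>
    simp only [lineP, algHom_C, Polynomial.algebraMap_eq, Polynomial.coeff_C, coeff_C]
    by_cases h : m = 0
    · simp [h]
    · rw [if_neg h, if_neg]
      intro h'
      exact h (Finsupp.single_eq_zero.mp h'.symm)
  | add p q hp hq => 
    have e : lineP (p + q) (Pi.single j 1) = lineP p (Pi.single j 1) + lineP q (Pi.single j 1) := by
      simp [lineP]
    rw [e, Polynomial.coeff_add, coeff_add, hp, hq]
  | mul_X p i hp =>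
    rw [lineP_mul_X, coeff_mul_X']
    cases m with
    | zero => simp
    | succ m =>
      rw [Polynomial.coeff_mul_X, Polynomial.coeff_mul_C, hp]
      by_cases h : i = j
      · subst h
        rw [if_pos (by simp)]
        simp [← Finsupp.single_tsub]
      · rw [if_neg]
        · simp [h]
        · simp [Finsupp.single_apply, Ne.symm h]

theorem lineP_pair [DecidableEq ι] (F : MvPolynomial ι K) (i j : ι) (hij : i ≠ j) :
    (lineP F (Pi.single i 1 + Pi.single j 1)).coeff 1 =
      F.coeff (Finsupp.single i 1) + F.coeff (Finsupp.single j 1) ∧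
    (lineP F (Pi.single i 1 + Pi.single j 1)).coeff 2 =
      F.coeff (Finsupp.single i 2) + F.coeff (Finsupp.single j 2) +
      F.coeff (Finsupp.single i 1 + Finsupp.single j 1) := by
  induction F using MvPolynomial.induction_on with
  | C a =>
    have h1 : ∀ k : ι, ∀ m, m ≠ 0 → (C a : MvPolynomial ι K).coeff (Finsupp.single k m) = 0 := by
      intro k m hm
      rw [coeff_C, if_neg]
      intro h'
      exact hm (Finsupp.single_eq_zero.mp h'.symm)
    have h2 : (C a : MvPolynomial ι K).coeff (Finsupp.single i 1 + Finsupp.single j 1) = 0 := by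
      rw [coeff_C, if_neg]
      intro h'
      have := DFunLike.congr_fun h' i
      simp at this
      omega
    rw [h1 _ 1 one_ne_zero, h1 _ 1 one_ne_zero, h1 _ 2 two_ne_zero, h1 _ 2 two_ne_zero, h2]
    simp [lineP, Polynomial.coeff_C]
  | add p q hp hq =>
    have e : lineP (p + q) (Pi.single i 1 + Pi.single j 1) =
        lineP p (Pi.single i 1 + Pi.single j 1) + lineP q (Pi.single i 1 + Pi.single j 1) := by
      simp [lineP]
    rw [e]
    simp only [Polynomial.coeff_add, coeff_add, hp.1, hp.2, hq.1, hq.2]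
    constructor <;> ring
  | mul_X p k hp =>
    rw [lineP_mul_X]
    simp only [Polynomial.coeff_mul_X, Polynomial.coeff_mul_C, coeff_mul_X', hp.1, lineP_coeff_zero]
    have hs : ∀ a b : ι, ∀ m, m ≠ 0 → (a ∈ (Finsupp.single b m).support ↔ a = b) := by
      intro a b m hm
      simp [Finsupp.single_apply, hm, eq_comm]
    have hs2 : k ∈ (Finsupp.single i 1 + Finsupp.single j 1 : ι →₀ ℕ).support ↔ k = i ∨ k = j := by
      simp only [Finsupp.mem_support_iff, Finsupp.add_apply, Finsupp.single_apply]
      by_cases h1 : i = k <;> by_cases h2 : j = k <;> simp [h1, h2, eq_comm]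
      all_goals (try (constructor <;> (intro h; first | exact h1 h.symm | exact h2 h.symm)))
    have c1 : ∀ a : ι, (if k ∈ (Finsupp.single a 1 : ι →₀ ℕ).support then
        coeff (Finsupp.single a 1 - Finsupp.single k 1) p else 0) = if k = a then coeff 0 p else 0 := by
      intro a
      simp only [hs _ _ _ one_ne_zero]
      split_ifs with h
      · subst h; simp
      · rfl
    have c2 : ∀ a : ι, (if k ∈ (Finsupp.single a 2 : ι →₀ ℕ).support then
        coeff (Finsupp.single a 2 - Finsupp.single k 1) p else 0) =
        if k = a then coeff (Finsupp.single a 1) p else 0 := by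
      intro a
      simp only [hs _ _ _ two_ne_zero]
      split_ifs with h
      · subst h; rw [← Finsupp.single_tsub]
      · rfl
    have c3 : (if k ∈ (Finsupp.single i 1 + Finsupp.single j 1 : ι →₀ ℕ).support then
        coeff (Finsupp.single i 1 + Finsupp.single j 1 - Finsupp.single k 1) p else 0) =
        (if k = i then coeff (Finsupp.single j 1) p else 0) +
        (if k = j then coeff (Finsupp.single i 1) p else 0) := by
      simp only [hs2]
      by_cases h1 : k = i
      · subst h1
        simp [hij]
      · by_cases h2 : k = j
        · subst h2
          simp [h1]
        · simp [h1, h2]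
    rw [c1, c1, c2, c2, c3]
    have hk : (Pi.single i 1 + Pi.single j 1 : ι → K) k = (if k = i then 1 else 0) + (if k = j then 1 else 0) := by
      simp [Pi.single_apply]
    rw [hk]
    constructor
    · split_ifs <;> simp_all
    · by_cases h1 : k = i
      · subst h1
        simp [hij]
      · by_cases h2 : k = j
        · subst h2
          simp [h1]
          ring
        · simp [h1, h2]

theorem lineP_subst {N : ℕ} (F : MvPolynomial ι K) (col : Fin N → ι → K) (w : Fin N → K) :
    lineP ((aeval (fun i : ι => ∑ j : Fin N, C (col j i) * X j)) F) w =
      lineP F (fun i => ∑ j, w j * col j i) := by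
  unfold lineP
  induction F using MvPolynomial.induction_on with
  | C a => simp
  | add p q hp hq => simp only [map_add, hp, hq]
  | mul_X p i hp =>
    simp only [map_mul, hp, aeval_X]
    congr 1
    simp only [map_sum, map_mul, aeval_X, algHom_C, Polynomial.algebraMap_eq, Finset.sum_mul]
    refine Finset.sum_congr rfl fun j _ => ?_
    ring
end

theorem adm_of_col {K : Type} [Field K] {ι : Type} [Fintype ι]
    {F : MvPolynomial ι K} (h1 : ∀ v, (lineP F v).coeff 1 = 0) (q : QuadraticForm K (ι → K))
    (hq : ∀ v, (lineP F v).coeff 2 = q v) {N : ℕ} (hN : Fintype.card ι = N)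
    (col : Fin N → ι → K) (hcol : LinearIndependent K col)
    (heven : N % 2 = 0 → (∀ i, q (col i) = 0) ∧ (∀ i j : Fin N, (i : ℕ) < (j : ℕ) →
      QuadraticMap.polar q (col i) (col j) =
        (if (i : ℕ) % 2 = 0 ∧ (j : ℕ) = (i : ℕ) + 1 then 1 else 0)))
    (hodd : N % 2 = 1 → (∀ i : Fin N, (i : ℕ) ≠ 0 → q (col i) = 0) ∧
      (∀ i j : Fin N, (i : ℕ) < (j : ℕ) → QuadraticMap.polar q (col i) (col j) =
        (if (i : ℕ) % 2 = 1 ∧ (j : ℕ) = (i : ℕ) + 1 then 1 else 0)) ∧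
      (∀ h0 : 0 < N, (lineP F (col ⟨0, h0⟩)).coeff 3 ≠ 0)) :
    AdmissibleLocalFunction K F := by
  let e : ι ≃ Fin N := Fintype.equivFinOfCardEq hN
  let T : Matrix (Fin N) (Fin N) K := Matrix.of fun i j => col j (e.symm i)
  refine ⟨N, e, T, ?_, ?_⟩
  · rw [← Matrix.isUnit_iff_isUnit_det, ← Matrix.linearIndependent_cols_iff_isUnit]
    have := hcol.map' (LinearEquiv.funCongrLeft K K e.symm).toLinearMap
      (LinearEquiv.ker _)
    exact this
  · have hT : (fun i : ι => ∑ j : Fin N, C (T (e i) j) * X j) =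
        (fun i : ι => ∑ j : Fin N, (C (col j i) * X j : MvPolynomial (Fin N) K)) := by
      funext i
      simp [T]
    rw [hT]
    set G := (aeval (fun i : ι => ∑ j : Fin N, (C (col j i) * X j : MvPolynomial (Fin N) K))) F with hG
    have s1 : ∀ j, lineP G (Pi.single j 1) = lineP F (col j) := by
      intro j
      rw [hG, lineP_subst]
      congr 1
      funext i
      simp [Pi.single_apply]
    have s2 : ∀ i j, lineP G (Pi.single i 1 + Pi.single j 1) = lineP F (col i + col j) := by
      intro i j
      rw [hG, lineP_subst]
      congr 1
      funext k
      simp [Pi.single_apply, add_mul, Finset.sum_add_distrib]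
    have c1 : ∀ j m, G.coeff (Finsupp.single j m) = (lineP F (col j)).coeff m := by
      intro j m
      rw [← lineP_single, s1]
    have c2 : ∀ i j : Fin N, (i : ℕ) < j → G.coeff (Finsupp.single i 1 + Finsupp.single j 1) =
        QuadraticMap.polar q (col i) (col j) := by
      intro i j hij
      have hne : i ≠ j := by rintro rfl; exact lt_irrefl _ hij
      have h := (lineP_pair G i j hne).2
      rw [s2, c1, c1, hq, hq, hq] at h
      rw [QuadraticMap.polar]
      linear_combination -h
    refine ⟨fun i => by rw [c1, h1], fun hN => ⟨fun i => ?_, fun i j hij => ?_⟩,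
      fun hN => ⟨fun i hi => ?_, fun i j hij => ?_, fun h0 => ?_⟩⟩
    · rw [c1, hq, (heven hN).1]
    · rw [c2 i j hij, (heven hN).2 i j hij]
    · rw [c1, hq, (hodd hN).1 i hi]
    · rw [c2 i j hij, (hodd hN).2.1 i j hij]
    · rw [c1]; exact (hodd hN).2.2 h0

theorem adm_of {K : Type} [Field K] [IsAlgClosed K] [CharP K 2] {ι : Type} [Fintype ι]
    {F : MvPolynomial ι K} (h1 : ∀ v, (lineP F v).coeff 1 = 0) (q : QuadraticForm K (ι → K))
    (hq : ∀ v, (lineP F v).coeff 2 = q v) (t : ι)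
    (H1 : ∀ v, (∀ w, QuadraticMap.polar q v w = 0) → v t = 0 → v = 0)
    (H2 : ∀ v, (∀ w, QuadraticMap.polar q v w = 0) → v ≠ 0 → (lineP F v).coeff 3 ≠ 0) :
    AdmissibleLocalFunction K F := by
  obtain ⟨r, g, H, hmax⟩ := exists_hyp q
  have hfr : Module.finrank K (ι → K) = Fintype.card ι := Module.finrank_fintype_fun_eq_card K
  have hl : LinearIndependent K (fun i : Fin (2 * r) => g i) := by
    rw [Fintype.linearIndependent_iff]
    intro a ha i
    exact H.coeff_zero 0 (by simp) a (by simpa using ha) i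
  have himg : g '' {i | i < 2 * r} = Set.range (fun i : Fin (2 * r) => g i) := by
    ext x; constructor
    · rintro ⟨i, hi, rfl⟩; exact ⟨⟨i, hi⟩, rfl⟩
    · rintro ⟨i, rfl⟩; exact ⟨i, i.2, rfl⟩
  by_cases hrad : ∃ v, (∀ w, QuadraticMap.polar q v w = 0) ∧ v ≠ 0
  · obtain ⟨v, hv, hv0⟩ := hrad
    have hvt : v t ≠ 0 := fun h => hv0 (H1 v hv h)
    have hradv : ∀ w, (∀ w', QuadraticMap.polar q w w' = 0) → w = (w t / v t) • v := by
      intro w hw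
      rw [← sub_eq_zero]
      apply H1
      · intro w'
        rw [QuadraticMap.polar_sub_left, QuadraticMap.polar_smul_left, hw, hv]; simp
      · simp [hvt]
    let col : Fin (2 * r + 1) → ι → K := Fin.cons v (fun i => g i)
    have hcol : LinearIndependent K col := by
      rw [Fintype.linearIndependent_iff]
      intro a ha
      rw [Fin.sum_univ_succ] at ha
      simp only [col, Fin.cons_zero, Fin.cons_succ] at ha
      have h2 := H.coeff_zero (a 0 • v) (fun w => by rw [QuadraticMap.polar_smul_left, hv]; simp)
        (fun i => a i.succ) ha
      simp only [h2, zero_smul, Finset.sum_const_zero, add_zero] at ha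
      refine Fin.cases ?_ h2
      exact (smul_eq_zero.mp ha).resolve_right hv0
    have hspan : Submodule.span K (Set.range col) = ⊤ := by
      rw [eq_top_iff]
      intro w _
      obtain ⟨w', hw, hw'⟩ := H.compl w
      have h3 := hradv w' (hmax w' hw')
      have : w = (w - w') + w' := by abel
      rw [this]
      refine Submodule.add_mem _ ?_ ?_
      · rw [himg] at hw
        refine Submodule.span_mono ?_ hw
        rintro _ ⟨i, rfl⟩
        exact ⟨i.succ, rfl⟩
      · rw [h3]
        exact Submodule.smul_mem _ _ (Submodule.subset_span ⟨0, rfl⟩)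
    have hN : Fintype.card ι = 2 * r + 1 := by
      have e1 := hcol.fintype_card_le_finrank
      have e2 := finrank_range_le_card (R := K) col
      rw [Set.finrank, hspan, finrank_top] at e2
      simp only [Fintype.card_fin] at e1 e2
      omega
    refine adm_of_col h1 q hq hN col hcol (fun h => by omega) (fun _ => ⟨?_, ?_, ?_⟩)
    · intro i
      refine Fin.cases (fun h => absurd rfl h) (fun i _ => ?_) i
      exact H.iso i i.2
    · intro i j
      refine Fin.cases (fun h => ?_) (fun i => ?_) i
      · simp only [col, Fin.cons_zero, hv]
        rw [if_neg (by simp)]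
      · refine Fin.cases (fun h => ?_) (fun j hij => ?_) j
        · simp at h
        · simp only [col, Fin.cons_succ]
          rw [H.pair i i.2 j j.2]
          simp only [Fin.val_succ] at hij ⊢
          by_cases hc : (i : ℕ) / 2 = j / 2 ∧ (i : ℕ) ≠ j
          · rw [if_pos hc, if_pos (by omega)]
          · rw [if_neg hc, if_neg (by omega)]
    · intro h0
      exact H2 v hv hv0
  · push Not at hrad
    have hspan : Submodule.span K (Set.range (fun i : Fin (2 * r) => g i)) = ⊤ := by
      rw [eq_top_iff]
      intro w _
      obtain ⟨w', hw, hw'⟩ := H.compl w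
      rw [hrad w' (hmax w' hw'), sub_zero, himg] at hw
      exact hw
    have hN : Fintype.card ι = 2 * r := by
      have e1 := hl.fintype_card_le_finrank
      have e2 := finrank_range_le_card (R := K) (fun i : Fin (2 * r) => g i)
      rw [Set.finrank, hspan, finrank_top] at e2
      simp only [Fintype.card_fin] at e1 e2
      omega
    refine adm_of_col h1 q hq hN _ hl (fun _ => ⟨fun i => H.iso i i.2, fun i j hij => ?_⟩)
      (fun h => by omega)
    rw [H.pair i i.2 j j.2]
    by_cases hc : (i : ℕ) / 2 = j / 2 ∧ (i : ℕ) ≠ j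
    · rw [if_pos hc, if_pos (by omega)]
    · rw [if_neg hc, if_neg (by omega)]

end

section
/-- index set of coefficients -/
abbrev CIdx (n : ℕ) (degs : Fin 4 → ℤ) : Type :=
  {c : Fin 4 × (Fin n →₀ ℕ) // ∑ i : Fin n, (c.2 i : ℤ) = degs c.1}

theorem finite_CIdx (n : ℕ) (degs : Fin 4 → ℤ) : Finite (CIdx n degs) := by
  let N : ℕ := ∑ i, (degs i).toNat
  have hb : ∀ (c : CIdx n degs) (i : Fin n), c.1.2 i < N + 1 := by
    intro c i
    have h1 : (c.1.2 i : ℤ) ≤ ∑ i : Fin n, (c.1.2 i : ℤ) :=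
      Finset.single_le_sum (f := fun i : Fin n => (c.1.2 i : ℤ)) (fun i _ => by positivity)
        (Finset.mem_univ i)
    have h2 : (degs c.1.1).toNat ≤ N :=
      Finset.single_le_sum (f := fun i => (degs i).toNat) (fun i _ => by positivity)
        (Finset.mem_univ _)
    have h3 := c.2
    omega
  refine Finite.of_injective (β := Fin 4 × (Fin n → Fin (N + 1)))
    (fun c => (c.1.1, fun i => ⟨c.1.2 i, hb c i⟩)) ?_
  rintro ⟨⟨i, e⟩, h⟩ ⟨⟨i', e'⟩, h'⟩ hh
  simp only [Prod.mk.injEq] at hh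
  obtain ⟨rfl, h2⟩ := hh
  have : e = e' := by
    ext j
    have := congrFun h2 j
    simpa using this
  subst this
  rfl

/-- generic property -/
def Gen (K : Type) [Field K] (n : ℕ) (degs : Fin 4 → ℤ)
    (Pred : (Fin 4 → MvPolynomial (Fin n) K) → Prop) : Prop :=
  ∃ D : MvPolynomial (CIdx n degs) K, D ≠ 0 ∧
    ∀ abcf : Fin 4 → MvPolynomial (Fin n) K,
      (∀ i, IsHomogZ K n (degs i) (abcf i)) →
      eval (fun c : CIdx n degs => (abcf c.1.1).coeff c.1.2) D ≠ 0 → Pred abcf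

section
variable {K : Type} [Field K] {n : ℕ} {degs : Fin 4 → ℤ}

theorem Gen.mono {P Q : (Fin 4 → MvPolynomial (Fin n) K) → Prop} (hP : Gen K n degs P)
    (h : ∀ a, (∀ i, IsHomogZ K n (degs i) (a i)) → P a → Q a) : Gen K n degs Q := by
  obtain ⟨D, h0, hD⟩ := hP
  exact ⟨D, h0, fun a ha hx => h a ha (hD a ha hx)⟩

theorem Gen.and {P Q : (Fin 4 → MvPolynomial (Fin n) K) → Prop} (hP : Gen K n degs P)
    (hQ : Gen K n degs Q) : Gen K n degs (fun a => P a ∧ Q a) := by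
  obtain ⟨D, h0, hD⟩ := hP
  obtain ⟨D', h0', hD'⟩ := hQ
  refine ⟨D * D', mul_ne_zero h0 h0', fun a ha hx => ?_⟩
  rw [map_mul] at hx
  exact ⟨hD a ha (left_ne_zero_of_mul hx), hD' a ha (right_ne_zero_of_mul hx)⟩

theorem Gen.forall {ι : Type} [Fintype ι] {P : ι → (Fin 4 → MvPolynomial (Fin n) K) → Prop}
    (hP : ∀ i, Gen K n degs (P i)) : Gen K n degs (fun a => ∀ i, P i a) := by
  choose D h0 hD using hP
  refine ⟨∏ i, D i, Finset.prod_ne_zero_iff.mpr fun i _ => h0 i, fun a ha hx i => ?_⟩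
  rw [map_prod, Finset.prod_ne_zero_iff] at hx
  exact hD i a ha (hx i (Finset.mem_univ i))

theorem Gen.trivial {P : (Fin 4 → MvPolynomial (Fin n) K) → Prop} (h : ∀ a, P a) :
    Gen K n degs P := ⟨1, one_ne_zero, fun a _ _ => h a⟩

theorem homog_eq_sum [Fintype (CIdx n degs)] (p : CIdx n degs → K) :
    ∀ i, IsHomogZ K n (degs i)
      ((∑ c : CIdx n degs, p c • (Pi.single c.1.1 (monomial c.1.2 (1 : K)) :
        Fin 4 → MvPolynomial (Fin n) K)) i) := by
  classical
  intro i e he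
  rw [mem_support_iff, Finset.sum_apply, coeff_sum] at he
  obtain ⟨c, -, hc⟩ := Finset.exists_ne_zero_of_sum_ne_zero he
  obtain ⟨⟨j, e'⟩, hj⟩ := c
  simp only [Pi.smul_apply, coeff_smul, Pi.single_apply] at hc
  split_ifs at hc with hij
  · subst hij
    rw [coeff_monomial] at hc
    split_ifs at hc with h
    · subst h; exact hj
    · simp at hc
  · simp at hc

theorem sum_coeff [Fintype (CIdx n degs)] (p : CIdx n degs → K) (c : CIdx n degs) :
      ((∑ c : CIdx n degs, p c • (Pi.single c.1.1 (monomial c.1.2 (1 : K)) :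
        Fin 4 → MvPolynomial (Fin n) K)) c.1.1).coeff c.1.2 = p c := by
  classical
  rw [Finset.sum_apply, coeff_sum, Finset.sum_eq_single c]
  · simp
  · rintro ⟨⟨j, e'⟩, hj⟩ - hne
    obtain ⟨⟨i, e⟩, hi⟩ := c
    simp only [Pi.smul_apply, coeff_smul, Pi.single_apply]
    split_ifs with hij
    · subst hij
      rw [coeff_monomial, if_neg]
      · simp
      · rintro rfl; exact hne rfl
    · simp
  · simp

theorem eq_sum_coeff [Fintype (CIdx n degs)] (a : Fin 4 → MvPolynomial (Fin n) K)
    (ha : ∀ i, IsHomogZ K n (degs i) (a i)) :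
    a = ∑ c : CIdx n degs, (a c.1.1).coeff c.1.2 •
      (Pi.single c.1.1 (monomial c.1.2 (1 : K)) : Fin 4 → MvPolynomial (Fin n) K) := by
  funext i
  ext e
  by_cases h : ∑ j : Fin n, (e j : ℤ) = degs i
  · exact (sum_coeff (fun c : CIdx n degs => (a c.1.1).coeff c.1.2) ⟨(i, e), h⟩).symm
  · rw [notMem_support_iff.mp (fun h' => h (ha i e h')),
      notMem_support_iff.mp (fun h' => h (homog_eq_sum _ i e h'))]

theorem Gen.generally [Infinite K] {P : (Fin 4 → MvPolynomial (Fin n) K) → Prop}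
    (hP : Gen K n degs P) : GenerallyHolds4 K n degs P := by
  obtain ⟨D, h0, hD⟩ := hP
  have : Finite (CIdx n degs) := finite_CIdx n degs
  have : Fintype (CIdx n degs) := Fintype.ofFinite _
  have hev : ∀ a : Fin 4 → MvPolynomial (Fin n) K, evalCoeff4 K a (rename Subtype.val D) =
      eval (fun c : CIdx n degs => (a c.1.1).coeff c.1.2) D := by
    intro a
    rw [evalCoeff4, eval_rename]
    rfl
  refine ⟨rename Subtype.val D, ?_, fun a ha hx => hD a ha (by rwa [← hev])⟩
  obtain ⟨p, hp⟩ : ∃ p, eval p D ≠ 0 := by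
    by_contra hc
    push Not at hc
    exact h0 (MvPolynomial.funext fun x => by rw [hc, map_zero])
  refine ⟨_, homog_eq_sum p, ?_⟩
  rw [hev]
  simp only [sum_coeff]
  exact hp

theorem gen_disc {ρ τ : Type} [Fintype ρ] [Fintype τ]
    (hc : Fintype.card τ < Fintype.card ρ)
    (row : (Fin 4 → MvPolynomial (Fin n) K) →ₗ[K] (ρ → MvPolynomial τ K)) :
    Gen K n degs (fun a => ∀ w : τ → K, (∀ r, eval w (row a r) = 0) →
      ¬ (∀ t : ρ → K, ∃ a', (∀ i, IsHomogZ K n (degs i) (a' i)) ∧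
        ∀ r, eval w (row a' r) = t r)) := by
  classical
  have : Finite (CIdx n degs) := finite_CIdx n degs
  have : Fintype (CIdx n degs) := Fintype.ofFinite _
  let M : Matrix ρ (CIdx n degs) (MvPolynomial τ K) := Matrix.of fun r c =>
    row (Pi.single c.1.1 (monomial c.1.2 (1 : K))) r
  obtain ⟨D, h0, hD⟩ := exists_disc hc M
  have key : ∀ a : Fin 4 → MvPolynomial (Fin n) K, (∀ i, IsHomogZ K n (degs i) (a i)) →
      ∀ w r, (M.map (eval w)).mulVec (fun c : CIdx n degs => (a c.1.1).coeff c.1.2) r =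
        eval w (row a r) := by
    intro a ha w r
    conv_rhs => rw [eq_sum_coeff a ha]
    simp only [map_sum, map_smul, Finset.sum_apply, Pi.smul_apply, smul_eval]
    simp [Matrix.mulVec, dotProduct, M, mul_comm]
  refine ⟨D, h0, fun a ha hx w hw hs => hx (hD _ w ?_ ?_)⟩
  · funext r
    rw [key a ha, hw]; rfl
  · intro t
    obtain ⟨a', ha', h⟩ := hs t
    exact ⟨_, funext fun r => by rw [key a' ha', h]⟩
end

end

section
noncomputable section
variable {K : Type} [Field K] {n : ℕ}

/-- restriction to a line -/
def LL {S : Type} [CommRing S] [Algebra K S] (u v : Fin n → S) :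
    MvPolynomial (Fin n) K →ₐ[K] Polynomial S :=
  aeval (fun j => Polynomial.C (u j) + Polynomial.C (v j) * Polynomial.X)

def PL {S : Type} [CommRing S] [Algebra K S] (x y z dx dy : S) (u v : Fin n → S) (w : S) :
    (Fin 4 → MvPolynomial (Fin n) K) →ₗ[K] Polynomial S where
  toFun a := LL u v (a 0) * (Polynomial.C x + Polynomial.C (w * dx) * Polynomial.X) ^ 2 +
    LL u v (a 1) * (Polynomial.C y + Polynomial.C (w * dy) * Polynomial.X) ^ 2 +
    LL u v (a 2) * Polynomial.C z +
    LL u v (a 3) * (Polynomial.C x + Polynomial.C (w * dx) * Polynomial.X) *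
      (Polynomial.C y + Polynomial.C (w * dy) * Polynomial.X)
  map_add' a b := by simp only [Pi.add_apply, map_add]; ring
  map_smul' k a := by
    simp only [Pi.smul_apply, map_smul, RingHom.id_apply, smul_add, smul_mul_assoc]

theorem PL_apply {S : Type} [CommRing S] [Algebra K S] (x y z dx dy : S) (u v : Fin n → S) (w : S)
    (a : Fin 4 → MvPolynomial (Fin n) K) : PL x y z dx dy u v w a =
    LL u v (a 0) * (Polynomial.C x + Polynomial.C (w * dx) * Polynomial.X) ^ 2 +
    LL u v (a 1) * (Polynomial.C y + Polynomial.C (w * dy) * Polynomial.X) ^ 2 +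
    LL u v (a 2) * Polynomial.C z +
    LL u v (a 3) * (Polynomial.C x + Polynomial.C (w * dx) * Polynomial.X) *
      (Polynomial.C y + Polynomial.C (w * dy) * Polynomial.X) := rfl

def cf {S : Type} [CommRing S] [Algebra K S] (k : ℕ) : Polynomial S →ₗ[K] S where
  toFun p := p.coeff k
  map_add' p q := by simp
  map_smul' c p := by simp

theorem cf_apply {S : Type} [CommRing S] [Algebra K S] (k : ℕ) (p : Polynomial S) :
    cf (K := K) k p = p.coeff k := rfl

theorem LL_map {S T : Type} [CommRing S] [Algebra K S] [CommRing T] [Algebra K T] (φ : S →ₐ[K] T)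
    (u v : Fin n → S) (g : MvPolynomial (Fin n) K) :
    (LL u v g).map (φ : S →+* T) = LL (fun i => φ (u i)) (fun i => φ (v i)) g := by
  have : (Polynomial.mapAlgHom φ).comp (LL u v : MvPolynomial (Fin n) K →ₐ[K] _) =
      LL (fun i => φ (u i)) (fun i => φ (v i)) := by
    apply MvPolynomial.algHom_ext
    intro i
    simp [LL]
  exact DFunLike.congr_fun this g

theorem PL_map {S T : Type} [CommRing S] [Algebra K S] [CommRing T] [Algebra K T] (φ : S →ₐ[K] T)
    (x y z dx dy : S) (u v : Fin n → S) (w : S)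
    (a : Fin 4 → MvPolynomial (Fin n) K) :
    (PL x y z dx dy u v w a).map (φ : S →+* T) =
      PL (φ x) (φ y) (φ z) (φ dx) (φ dy) (fun i => φ (u i)) (fun i => φ (v i)) (φ w) a := by
  simp [PL_apply, ← LL_map]

/-- k-th coefficient functional -/
def DD {S : Type} [CommRing S] [Algebra K S] (k : ℕ) (x y z dx dy : S) (u v : Fin n → S) (w : S) :
    (Fin 4 → MvPolynomial (Fin n) K) →ₗ[K] S := cf k ∘ₗ PL x y z dx dy u v w

def CC {S : Type} [CommRing S] [Algebra K S] (k : ℕ) (i : Fin 4) (u v : Fin n → S) :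
    (Fin 4 → MvPolynomial (Fin n) K) →ₗ[K] S :=
  cf k ∘ₗ (LL u v).toLinearMap ∘ₗ LinearMap.proj i

theorem DD_map {S T : Type} [CommRing S] [Algebra K S] [CommRing T] [Algebra K T] (φ : S →ₐ[K] T)
    (k : ℕ) (x y z dx dy : S) (u v : Fin n → S) (w : S)
    (a : Fin 4 → MvPolynomial (Fin n) K) :
    φ (DD k x y z dx dy u v w a) =
      DD k (φ x) (φ y) (φ z) (φ dx) (φ dy) (fun i => φ (u i)) (fun i => φ (v i)) (φ w) a := by
  have := congrArg (fun p => Polynomial.coeff p k) (PL_map φ x y z dx dy u v w a)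
  simpa [DD, cf_apply] using this

theorem CC_map {S T : Type} [CommRing S] [Algebra K S] [CommRing T] [Algebra K T] (φ : S →ₐ[K] T)
    (k : ℕ) (i : Fin 4) (u v : Fin n → S)
    (a : Fin 4 → MvPolynomial (Fin n) K) :
    φ (CC k i u v a) = CC k i (fun i => φ (u i)) (fun i => φ (v i)) a := by
  have := congrArg (fun p => Polynomial.coeff p k) (LL_map φ u v (a i))
  simpa [CC, cf_apply] using this

def BB {S : Type} [CommRing S] [Algebra K S] (x y z dx dy : S) (u v : Fin n → S) (w : S)
    (v' : Fin n → S) (w' : S) :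
    (Fin 4 → MvPolynomial (Fin n) K) →ₗ[K] S :=
  DD 2 x y z dx dy u (v + v') (w + w') - DD 2 x y z dx dy u v w - DD 2 x y z dx dy u v' w'

theorem BB_map {S T : Type} [CommRing S] [Algebra K S] [CommRing T] [Algebra K T] (φ : S →ₐ[K] T)
    (x y z dx dy : S) (u v : Fin n → S) (w : S) (v' : Fin n → S) (w' : S)
    (a : Fin 4 → MvPolynomial (Fin n) K) :
    φ (BB x y z dx dy u v w v' w' a) =
      BB (φ x) (φ y) (φ z) (φ dx) (φ dy) (fun i => φ (u i)) (fun i => φ (v i)) (φ w)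
        (fun i => φ (v' i)) (φ w') a := by
  simp only [BB, LinearMap.sub_apply, map_sub, DD_map, Pi.add_apply, map_add]
  rfl

/-- rows of type II -/
def rowII {S : Type} [CommRing S] [Algebra K S] (i0 k0 : Fin n)
    (x y z dx dy : S) (u v : Fin n → S) (w s : S) :
    (Fin 4 → MvPolynomial (Fin n) K) →ₗ[K]
      (({j : Fin n // j ≠ i0} ⊕ {j : Fin n // j ≠ i0 ∧ j ≠ k0} ⊕ Fin 5) → S) :=
  LinearMap.pi (Sum.elim (fun j => DD 1 x y z dx dy u (Pi.single j.1 1) 0)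
    (Sum.elim (fun j => BB x y z dx dy u v w (Pi.single j.1 1) 0)
      ![DD 0 x y z dx dy u 0 0, DD 1 x y z dx dy u 0 1, BB x y z dx dy u v w 0 1,
        DD 2 x y z dx dy u v w - LinearMap.mulLeft K s ∘ₗ CC 0 2 u v,
        DD 3 x y z dx dy u v w - LinearMap.mulLeft K s ∘ₗ CC 1 2 u v]))

theorem map_single_one {S T : Type} [CommRing S] [Algebra K S] [CommRing T] [Algebra K T]
    (φ : S →ₐ[K] T) (j : Fin n) :
    (fun i => φ ((Pi.single j 1 : Fin n → S) i)) = Pi.single j 1 := by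
  funext i
  by_cases h : i = j
  · subst h; simp
  · simp [h]

theorem rowII_map {S T : Type} [CommRing S] [Algebra K S] [CommRing T] [Algebra K T]
    (φ : S →ₐ[K] T) (i0 k0 : Fin n)
    (x y z dx dy : S) (u v : Fin n → S) (w s : S)
    (a : Fin 4 → MvPolynomial (Fin n) K) (r) :
    φ (rowII i0 k0 x y z dx dy u v w s a r) =
      rowII i0 k0 (φ x) (φ y) (φ z) (φ dx) (φ dy) (fun i => φ (u i)) (fun i => φ (v i)) (φ w)
        (φ s) a r := by
  have h0 : (fun _ => 0 : Fin n → T) = 0 := rfl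
  rcases r with j | j | r
  · simp [rowII, DD_map, map_single_one]
  · simp [rowII, BB_map, map_single_one]
  · fin_cases r <;> simp [rowII, DD_map, BB_map, CC_map, h0]

/-- test polynomial -/
def tA (i0 k0 : Fin n) (u : Fin n → K) (N : ℕ) (α : K) (b m : Fin n → K) (κ : K) :
    MvPolynomial (Fin n) K :=
  C α * X i0 ^ (N + 3) + (∑ j, C (b j) * (X j - C (u j) * X i0)) * X i0 ^ (N + 2) +
    (X k0 - C (u k0) * X i0) * (∑ j, C (m j) * (X j - C (u j) * X i0)) * X i0 ^ (N + 1) +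
    C κ * (X k0 - C (u k0) * X i0) ^ 3 * X i0 ^ N

def tF (i0 : Fin n) (u : Fin n → K) (N : ℕ) (γ : K) (b : Fin n → K) :
    MvPolynomial (Fin n) K :=
  C γ * X i0 ^ (N + 1) + (∑ j, C (b j) * (X j - C (u j) * X i0)) * X i0 ^ N

theorem homogZ_of {p : MvPolynomial (Fin n) K} {N : ℕ} (h : p.IsHomogeneous N) {d : ℤ}
    (hd : d = N) : IsHomogZ K n d p := by
  intro e he
  have := h (mem_support_iff.mp he)
  rw [Finsupp.weight_apply, Finsupp.sum_fintype _ _ (by simp)] at this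
  rw [hd, ← this]
  simp

theorem hom_lin (i0 : Fin n) (u : Fin n → K) (j : Fin n) :
    (X j - C (u j) * X i0 : MvPolynomial (Fin n) K).IsHomogeneous 1 := by
  refine (isHomogeneous_X K j).sub ?_
  simpa using (isHomogeneous_C (Fin n) (u j)).mul (isHomogeneous_X K i0)

theorem hom_sum (i0 : Fin n) (u b : Fin n → K) :
    (∑ j, C (b j) * (X j - C (u j) * X i0) : MvPolynomial (Fin n) K).IsHomogeneous 1 := by
  refine IsHomogeneous.sum _ _ _ fun j _ => ?_
  simpa using (isHomogeneous_C (Fin n) (b j)).mul (hom_lin i0 u j)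

theorem hom_Xpow (i0 : Fin n) (N : ℕ) :
    (X i0 ^ N : MvPolynomial (Fin n) K).IsHomogeneous N := by
  simpa using (isHomogeneous_X K i0).pow N

theorem hom_tA (i0 k0 : Fin n) (u : Fin n → K) (N : ℕ) (α : K) (b m : Fin n → K) (κ : K) :
    (tA i0 k0 u N α b m κ).IsHomogeneous (N + 3) := by
  refine ((IsHomogeneous.add ?_ ?_).add ?_).add ?_
  · have := (isHomogeneous_C (Fin n) α).mul (hom_Xpow (K := K) i0 (N + 3))
    rwa [zero_add] at this
  · have := (hom_sum i0 u b).mul (hom_Xpow (K := K) i0 (N + 2))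
    rwa [show 1 + (N + 2) = N + 3 by ring] at this
  · have := ((hom_lin i0 u k0).mul (hom_sum i0 u m)).mul (hom_Xpow (K := K) i0 (N + 1))
    rwa [show 1 + 1 + (N + 1) = N + 3 by ring] at this
  · have := ((isHomogeneous_C (Fin n) κ).mul ((hom_lin i0 u k0).pow 3)).mul (hom_Xpow (K := K) i0 N)
    rwa [show 0 + 1 * 3 + N = N + 3 by ring] at this

theorem hom_tF (i0 : Fin n) (u : Fin n → K) (N : ℕ) (γ : K) (b : Fin n → K) :
    (tF i0 u N γ b).IsHomogeneous (N + 1) := by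
  refine IsHomogeneous.add ?_ ?_
  · have := (isHomogeneous_C (Fin n) γ).mul (hom_Xpow (K := K) i0 (N + 1))
    rwa [zero_add] at this
  · have := (hom_sum i0 u b).mul (hom_Xpow (K := K) i0 N)
    rwa [show 1 + N = N + 1 by ring] at this

theorem LL_lin (i0 : Fin n) (u v : Fin n → K) (hu : u i0 = 1) (hv : v i0 = 0) (j : Fin n) :
    LL u v (X j - C (u j) * X i0 : MvPolynomial (Fin n) K) =
      Polynomial.C (v j) * Polynomial.X := by
  simp [LL, hu, hv]

theorem LL_X (i0 : Fin n) (u v : Fin n → K) (hu : u i0 = 1) (hv : v i0 = 0) :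
    LL u v (X i0 : MvPolynomial (Fin n) K) = 1 := by
  simp [LL, hu, hv]

theorem LL_C (u v : Fin n → K) (c : K) :
    LL u v (C c : MvPolynomial (Fin n) K) = Polynomial.C c := by
  simp [LL]

theorem LL_sum (i0 : Fin n) (u v b : Fin n → K) (hu : u i0 = 1) (hv : v i0 = 0) :
    LL u v (∑ j, C (b j) * (X j - C (u j) * X i0) : MvPolynomial (Fin n) K) =
      Polynomial.C (∑ j, b j * v j) * Polynomial.X := by
  simp only [map_sum, map_mul, LL_lin i0 u v hu hv, LL_C, Finset.sum_mul]
  refine Finset.sum_congr rfl fun j _ => ?_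
  ring

theorem LL_tA (i0 k0 : Fin n) (u v : Fin n → K) (hu : u i0 = 1) (hv : v i0 = 0)
    (N : ℕ) (α : K) (b m : Fin n → K) (κ : K) :
    LL u v (tA i0 k0 u N α b m κ) = Polynomial.C α +
      Polynomial.C (∑ j, b j * v j) * Polynomial.X +
      Polynomial.C (v k0 * ∑ j, m j * v j) * Polynomial.X ^ 2 +
      Polynomial.C (κ * v k0 ^ 3) * Polynomial.X ^ 3 := by
  rw [tA]
  simp only [map_add, map_mul (LL u v), map_pow (LL u v), LL_sum i0 u v _ hu hv, LL_lin i0 u v hu hv,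
    LL_X i0 u v hu hv, LL_C]
  simp only [map_mul, map_pow]
  ring

theorem LL_tF (i0 : Fin n) (u v : Fin n → K) (hu : u i0 = 1) (hv : v i0 = 0)
    (N : ℕ) (γ : K) (b : Fin n → K) :
    LL u v (tF i0 u N γ b) = Polynomial.C γ +
      Polynomial.C (∑ j, b j * v j) * Polynomial.X := by
  rw [tF]
  simp only [map_add, map_mul (LL u v), map_pow (LL u v), LL_sum i0 u v _ hu hv,
    LL_X i0 u v hu hv, LL_C]
  ring

theorem PL_test [CharP K 2] (i0 k0 : Fin n) (u v : Fin n → K) (hu : u i0 = 1) (hv : v i0 = 0)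
    (N N' : ℕ) (α : K) (b m : Fin n → K) (κ γ : K) (φ : K)
    (x y z dx dy w : K) (hη : dx * y + dy * x = 1) (hd : dx * dy = 0) :
    PL x y z dx dy u v w ![tA i0 k0 u N α b m κ, 0, 0, tF i0 u N' γ (Pi.single k0 φ)] =
    (Polynomial.C α + Polynomial.C (∑ j, b j * v j) * Polynomial.X +
      Polynomial.C (v k0 * ∑ j, m j * v j) * Polynomial.X ^ 2 +
      Polynomial.C (κ * v k0 ^ 3) * Polynomial.X ^ 3) *
        (Polynomial.C (x ^ 2) + Polynomial.C (w ^ 2 * dx ^ 2) * Polynomial.X ^ 2) +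
      (Polynomial.C γ + Polynomial.C (φ * v k0) * Polynomial.X) *
        (Polynomial.C (x * y) + Polynomial.C w * Polynomial.X) := by
  have h2 : (2 : Polynomial K) = 0 := by
    have := CharTwo.two_eq_zero (R := K)
    rw [← map_ofNat Polynomial.C 2, this, map_zero]
  have hη' := congrArg Polynomial.C hη
  have hd' := congrArg Polynomial.C hd
  have hs : ∑ j, (Pi.single k0 φ : Fin n → K) j * v j = φ * v k0 := by
    simp [Pi.single_apply]
  rw [PL_apply]
  simp only [Matrix.cons_val_zero, Matrix.cons_val_one, Matrix.cons_val, LL_tA i0 k0 u v hu hv,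
    LL_tF i0 u v hu hv, hs, map_zero]
  simp only [map_mul, map_add, map_pow, map_one, map_zero] at hη' hd' ⊢
  linear_combination (Polynomial.C γ + Polynomial.C φ * Polynomial.C (v k0) * Polynomial.X) *
      (Polynomial.C w * Polynomial.X * hη' + Polynomial.C w ^ 2 * Polynomial.X ^ 2 * hd') +
    (Polynomial.C α + Polynomial.C (∑ j, b j * v j) * Polynomial.X +
      Polynomial.C (v k0) * Polynomial.C (∑ j, m j * v j) * Polynomial.X ^ 2 +
      Polynomial.C κ * Polynomial.C (v k0) ^ 3 * Polynomial.X ^ 3) *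
      Polynomial.C x * Polynomial.C w * Polynomial.C dx * Polynomial.X * h2

end

end

section
noncomputable section
variable {K : Type} [Field K] {n : ℕ}

theorem DD_test [CharP K 2] (i0 k0 : Fin n) (u v : Fin n → K) (hu : u i0 = 1) (hv : v i0 = 0)
    (N N' : ℕ) (α : K) (b m : Fin n → K) (κ γ : K) (φ : K)
    (x y z dx dy w : K) (hη : dx * y + dy * x = 1) (hd : dx * dy = 0) 
    (a) (ha : a = ![tA i0 k0 u N α b m κ, 0, 0, tF i0 u N' γ (Pi.single k0 φ)]) :
    DD 0 x y z dx dy u v w a = x ^ 2 * α + x * y * γ ∧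
    DD 1 x y z dx dy u v w a = x ^ 2 * (∑ j, b j * v j) + w * γ + φ * v k0 * (x * y) ∧
    DD 2 x y z dx dy u v w a = x ^ 2 * (v k0 * ∑ j, m j * v j) + w ^ 2 * dx ^ 2 * α +
      φ * v k0 * w ∧
    DD 3 x y z dx dy u v w a = x ^ 2 * (κ * v k0 ^ 3) + w ^ 2 * dx ^ 2 * (∑ j, b j * v j) := by
  subst ha
  have h := PL_test i0 k0 u v hu hv N N' α b m κ γ φ x y z dx dy w hη hd
  have h' : PL x y z dx dy u v w ![tA i0 k0 u N α b m κ, 0, 0, tF i0 u N' γ (Pi.single k0 φ)] =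
      Polynomial.C (x ^ 2 * α + x * y * γ) +
      Polynomial.C (x ^ 2 * (∑ j, b j * v j) + w * γ + φ * v k0 * (x * y)) * Polynomial.X +
      Polynomial.C (x ^ 2 * (v k0 * ∑ j, m j * v j) + w ^ 2 * dx ^ 2 * α + φ * v k0 * w) *
        Polynomial.X ^ 2 +
      Polynomial.C (x ^ 2 * (κ * v k0 ^ 3) + w ^ 2 * dx ^ 2 * (∑ j, b j * v j)) *
        Polynomial.X ^ 3 +
      Polynomial.C (w ^ 2 * dx ^ 2 * (v k0 * ∑ j, m j * v j)) * Polynomial.X ^ 4 +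
      Polynomial.C (w ^ 2 * dx ^ 2 * (κ * v k0 ^ 3)) * Polynomial.X ^ 5 := by
    rw [h]
    simp only [map_mul, map_add, map_pow]
    ring
  simp only [DD, LinearMap.comp_apply, cf_apply, h']
  simp only [Polynomial.coeff_add, Polynomial.coeff_C_mul, Polynomial.coeff_X_pow,
    Polynomial.coeff_C, Polynomial.coeff_X]
  simp

theorem CC_zero {S : Type} [CommRing S] [Algebra K S] (k : ℕ) (i : Fin 4) (u v : Fin n → S)
    (a : Fin 4 → MvPolynomial (Fin n) K) (h : a i = 0) : CC k i u v a = 0 := by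
  simp [CC, h]

theorem surjII [CharP K 2] (i0 k0 : Fin n) (hk : k0 ≠ i0) (degs : Fin 4 → ℤ)
    (hA : 3 ≤ degs 0) (hF : 1 ≤ degs 3)
    (u v : Fin n → K) (hu : u i0 = 1) (hv : v i0 = 0) (hvk : v k0 = 1)
    (x y z dx dy w s : K) (hx : x ≠ 0) (hη : dx * y + dy * x = 1) (hd : dx * dy = 0)
    (t : ({j : Fin n // j ≠ i0} ⊕ {j : Fin n // j ≠ i0 ∧ j ≠ k0} ⊕ Fin 5) → K) :
    ∃ a', (∀ i, IsHomogZ K n (degs i) (a' i)) ∧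
        ∀ r, rowII i0 k0 x y z dx dy u v w s a' r = t r := by
  obtain ⟨N, hN⟩ : ∃ N : ℕ, degs 0 = (N + 3 : ℕ) := ⟨(degs 0 - 3).toNat, by push_cast; omega⟩
  obtain ⟨N', hN'⟩ : ∃ N : ℕ, degs 3 = (N + 1 : ℕ) := ⟨(degs 3 - 1).toNat, by push_cast; omega⟩
  have h2 : (2 : K) = 0 := CharTwo.two_eq_zero
  let t' : Fin 5 → K := fun r => t (Sum.inr (Sum.inr r))
  let γ := t' 1
  let φ := t' 2
  let α := (t' 0 - x * y * γ) / x ^ 2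
  let b : Fin n → K := fun j => if h : j = i0 then 0 else
    (t (Sum.inl ⟨j, h⟩) - φ * (Pi.single j 1 : Fin n → K) k0 * (x * y)) / x ^ 2
  let m0 : Fin n → K := fun j => if h : j ≠ i0 ∧ j ≠ k0 then
    t (Sum.inr (Sum.inl ⟨j, h⟩)) / x ^ 2 else 0
  let mk : K := (t' 3 - w ^ 2 * dx ^ 2 * α - φ * w) / x ^ 2 - ∑ j, m0 j * v j
  let m : Fin n → K := fun j => m0 j + (Pi.single k0 mk : Fin n → K) j
  let κ := (t' 4 - w ^ 2 * dx ^ 2 * (∑ j, b j * v j)) / x ^ 2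
  have hm : ∑ j, m j * v j = (t' 3 - w ^ 2 * dx ^ 2 * α - φ * w) / x ^ 2 := by
    simp only [m, add_mul, Finset.sum_add_distrib]
    simp [Pi.single_apply, hvk, mk]
  have hx2 : x ^ 2 ≠ 0 := pow_ne_zero _ hx
  let a' : Fin 4 → MvPolynomial (Fin n) K :=
    ![tA i0 k0 u N α b m κ, 0, 0, tF i0 u N' γ (Pi.single k0 φ)]
  have T := fun (v : Fin n → K) (hv : v i0 = 0) (w : K) =>
    DD_test i0 k0 u v hu hv N N' α b m κ γ φ x y z dx dy w hη hd a' rfl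
  have hsingle : ∀ j, j ≠ i0 → (Pi.single j 1 : Fin n → K) i0 = 0 := by
    intro j hj
    simp [Ne.symm hj]
  have hsum : ∀ (g : Fin n → K) (j : Fin n), ∑ i, g i * (Pi.single j 1 : Fin n → K) i = g j := by
    intro g j
    simp [Pi.single_apply]
  refine ⟨a', ?_, ?_⟩
  · intro i
    fin_cases i
    · exact homogZ_of (hom_tA i0 k0 u N α b m κ) hN
    · intro e he; simp [a'] at he
    · intro e he; simp [a'] at he
    · exact homogZ_of (hom_tF i0 u N' γ _) hN'
  · rintro (⟨j, hj⟩ | ⟨j, hj⟩ | r)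
    · simp only [rowII, LinearMap.pi_apply, Sum.elim_inl]
      rw [(T _ (hsingle j hj) 0).2.1, hsum]
      simp only [b, dif_neg hj]
      field_simp
      ring
    · simp only [rowII, LinearMap.pi_apply, Sum.elim_inl, Sum.elim_inr, BB, LinearMap.sub_apply]
      rw [(T _ (hsingle j hj.1) 0).2.2.1, (T _ hv w).2.2.1,
        (T _ (by rw [Pi.add_apply, hv, hsingle j hj.1, add_zero]) (w + 0)).2.2.1]
      have e1 : (Pi.single j 1 : Fin n → K) k0 = 0 := by simp [Ne.symm hj.2]
      have e2 : ∑ i, m i * (v + Pi.single j 1 : Fin n → K) i = (∑ i, m i * v i) + m j := by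
        simp only [Pi.add_apply, mul_add, Finset.sum_add_distrib, hsum]
      have e3 : m j = t (Sum.inr (Sum.inl ⟨j, hj⟩)) / x ^ 2 := by
        simp only [m, m0, dif_pos hj]
        simp [hj.2]
      rw [e2, Pi.add_apply, e1, hvk, e3]
      field_simp
      ring
    · have c0 : ∀ k, CC k 2 u v a' = 0 := fun k => CC_zero k 2 u v a' rfl
      have z0 : (0 : Fin n → K) i0 = 0 := rfl
      fin_cases r
      · simp [rowII]
        rw [(T 0 z0 0).1]
        simp only [α]
        field_simp
        ring
      · simp [rowII]
        rw [(T 0 z0 1).2.1]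
        simp [γ, t']
      · simp [rowII, BB]
        rw [(T 0 z0 1).2.2.1, (T v hv w).2.2.1, (T v hv (w + 1)).2.2.1, hvk]
        simp only [Pi.zero_apply]
        linear_combination dx ^ 2 * w * α * h2
      · simp [rowII]
        rw [(T v hv w).2.2.1, c0, hm, hvk]
        field_simp
        ring
      · simp [rowII]
        rw [(T v hv w).2.2.2, c0, hvk]
        simp only [κ]
        field_simp
        ring

end

end

section
noncomputable section
variable {K : Type} [Field K] {n : ℕ}

def xx {S : Type} [One S] (ch : Bool) (p : S) : S := match ch with
  | true => 1
  | false => p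
def yy {S : Type} [One S] (ch : Bool) (p : S) : S := match ch with
  | true => p
  | false => 1
def dxx {S : Type} [One S] [Zero S] (ch : Bool) : S := match ch with
  | true => 0
  | false => 1
def dyy {S : Type} [One S] [Zero S] (ch : Bool) : S := match ch with
  | true => 1
  | false => 0

theorem xx_map {S T : Type} [CommRing S] [Algebra K S] [CommRing T] [Algebra K T]
    (φ : S →ₐ[K] T) (ch : Bool) (p : S) : φ (xx ch p) = xx ch (φ p) := by
  cases ch <;> simp [xx]
theorem yy_map {S T : Type} [CommRing S] [Algebra K S] [CommRing T] [Algebra K T]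
    (φ : S →ₐ[K] T) (ch : Bool) (p : S) : φ (yy ch p) = yy ch (φ p) := by
  cases ch <;> simp [yy]
theorem dxx_map {S T : Type} [CommRing S] [Algebra K S] [CommRing T] [Algebra K T]
    (φ : S →ₐ[K] T) (ch : Bool) : φ (dxx ch) = dxx ch := by
  cases ch <;> simp [dxx]
theorem dyy_map {S T : Type} [CommRing S] [Algebra K S] [CommRing T] [Algebra K T]
    (φ : S →ₐ[K] T) (ch : Bool) : φ (dyy ch) = dyy ch := by
  cases ch <;> simp [dyy]
theorem eta_ch (ch : Bool) (p : K) : dxx ch * yy ch p + dyy ch * xx ch p = 1 := by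
  cases ch <;> simp [dxx, dyy, xx, yy]
theorem dd_ch (ch : Bool) : (dxx ch : K) * dyy ch = 0 := by
  cases ch <;> simp [dxx, dyy]

theorem eval_eq_aeval {τ : Type} (w : τ → K) (p : MvPolynomial τ K) : eval w p = aeval w p := by
  rw [aeval_eq_eval]

theorem genII [CharP K 2] (i0 k0 : Fin n) (hk : k0 ≠ i0) (degs : Fin 4 → ℤ)
    (hA : 3 ≤ degs 0) (hF : 1 ≤ degs 3) (ch : Bool) :
    Gen K n degs (fun a => ∀ (u v : Fin n → K) (p z w s : K), u i0 = 1 → v i0 = 0 → v k0 = 1 →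
      xx ch p ≠ 0 →
      ¬ ∀ r, rowII i0 k0 (xx ch p) (yy ch p) z (dxx ch) (dyy ch) u v w s a r = 0) := by
  let τ := {j : Fin n // j ≠ i0} ⊕ {j : Fin n // j ≠ i0 ∧ j ≠ k0} ⊕ Fin 4
  let ρ := {j : Fin n // j ≠ i0} ⊕ {j : Fin n // j ≠ i0 ∧ j ≠ k0} ⊕ Fin 5
  let U : Fin n → MvPolynomial τ K := fun j => if h : j = i0 then 1 else X (Sum.inl ⟨j, h⟩)
  let V : Fin n → MvPolynomial τ K := fun j => if h : j ≠ i0 ∧ j ≠ k0 then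
    X (Sum.inr (Sum.inl ⟨j, h⟩)) else if j = i0 then 0 else 1
  let e : Fin 4 → MvPolynomial τ K := fun i => X (Sum.inr (Sum.inr i))
  refine (gen_disc (ρ := ρ) (τ := τ) (by simp [ρ, τ])
    (rowII i0 k0 (xx ch (e 0)) (yy ch (e 0)) (e 1) (dxx ch) (dyy ch) U V (e 2) (e 3))).mono ?_
  intro a ha h u v p z w s hu hv hvk hx hr
  let W : τ → K := Sum.elim (fun j => u j) (Sum.elim (fun j => v j) ![p, z, w, s])
  have hW : ∀ (a : Fin 4 → MvPolynomial (Fin n) K) r, eval W (rowII i0 k0 (xx ch (e 0)) (yy ch (e 0)) (e 1) (dxx ch) (dyy ch) U V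
      (e 2) (e 3) a r) = rowII i0 k0 (xx ch p) (yy ch p) z (dxx ch) (dyy ch) u v w s a r := by
    intro a r
    rw [eval_eq_aeval, rowII_map, xx_map, yy_map, dxx_map, dyy_map]
    have h1 : (fun i => aeval W (U i)) = u := by
      funext i
      by_cases h : i = i0
      · subst h; simp [U, hu]
      · simp [U, h, W]
    have h2 : (fun i => aeval W (V i)) = v := by
      funext i
      by_cases h : i ≠ i0 ∧ i ≠ k0
      · simp only [V, dif_pos h]; simp [W]
      · simp only [V, dif_neg h]
        by_cases h' : i = i0
        · subst h'; simp [hv]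
        · have : i = k0 := by tauto
          subst this; simp [h', hvk]
    rw [h1, h2]
    simp [e, W]
  refine h W (fun r => by rw [hW, hr]) (fun t => ?_)
  obtain ⟨a', h1, h2⟩ := surjII i0 k0 hk degs hA hF u v hu hv hvk (xx ch p) (yy ch p) z (dxx ch)
    (dyy ch) w s hx (eta_ch ch p) (dd_ch ch) t
  exact ⟨a', h1, fun r => by rw [hW, h2]⟩

def inc {A B : Type} : A ⊕ B ⊕ Fin 3 → A ⊕ B ⊕ Fin 5 :=
  Sum.map id (Sum.map id (Fin.castLE (by norm_num)))

theorem inc_injective {A B : Type} : Function.Injective (inc (A := A) (B := B)) :=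
  Function.Injective.sumMap Function.injective_id
    (Function.Injective.sumMap Function.injective_id (Fin.castLE_injective _))

theorem genI [CharP K 2] (i0 k0 : Fin n) (hk : k0 ≠ i0) (degs : Fin 4 → ℤ)
    (hA : 3 ≤ degs 0) (hF : 1 ≤ degs 3) (ch : Bool) :
    Gen K n degs (fun a => ∀ (u v : Fin n → K) (p z : K), u i0 = 1 → v i0 = 0 → v k0 = 1 →
      xx ch p ≠ 0 →
      ¬ ∀ r, rowII i0 k0 (xx ch p) (yy ch p) z (dxx ch) (dyy ch) u v 0 0 a (inc r) = 0) := by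
  let τ := {j : Fin n // j ≠ i0} ⊕ {j : Fin n // j ≠ i0 ∧ j ≠ k0} ⊕ Fin 2
  let ρ := {j : Fin n // j ≠ i0} ⊕ {j : Fin n // j ≠ i0 ∧ j ≠ k0} ⊕ Fin 3
  let U : Fin n → MvPolynomial τ K := fun j => if h : j = i0 then 1 else X (Sum.inl ⟨j, h⟩)
  let V : Fin n → MvPolynomial τ K := fun j => if h : j ≠ i0 ∧ j ≠ k0 then
    X (Sum.inr (Sum.inl ⟨j, h⟩)) else if j = i0 then 0 else 1
  let e : Fin 2 → MvPolynomial τ K := fun i => X (Sum.inr (Sum.inr i))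
  refine (gen_disc (ρ := ρ) (τ := τ) (by simp [ρ, τ])
    ((LinearMap.funLeft K (MvPolynomial τ K) inc) ∘ₗ
    (rowII i0 k0 (xx ch (e 0)) (yy ch (e 0)) (e 1) (dxx ch) (dyy ch) U V 0 0))).mono ?_
  intro a ha h u v p z hu hv hvk hx hr
  let W : τ → K := Sum.elim (fun j => u j) (Sum.elim (fun j => v j) ![p, z])
  have hW : ∀ (a : Fin 4 → MvPolynomial (Fin n) K) r, eval W (((LinearMap.funLeft K (MvPolynomial τ K) inc) ∘ₗ
      (rowII i0 k0 (xx ch (e 0)) (yy ch (e 0)) (e 1) (dxx ch) (dyy ch) U V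
      0 0)) a r) = rowII i0 k0 (xx ch p) (yy ch p) z (dxx ch) (dyy ch) u v 0 0 a (inc r) := by
    intro a r
    rw [LinearMap.comp_apply, LinearMap.funLeft_apply,
      eval_eq_aeval, rowII_map, xx_map, yy_map, dxx_map, dyy_map]
    have h1 : (fun i => aeval W (U i)) = u := by
      funext i
      by_cases h : i = i0
      · subst h; simp [U, hu]
      · simp [U, h, W]
    have h2 : (fun i => aeval W (V i)) = v := by
      funext i
      by_cases h : i ≠ i0 ∧ i ≠ k0
      · simp only [V, dif_pos h]; simp [W]
      · simp only [V, dif_neg h]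
        by_cases h' : i = i0
        · subst h'; simp [hv]
        · have : i = k0 := by tauto
          subst this; simp [h', hvk]
    rw [h1, h2]
    simp [e, W]
  refine h W (fun r => by rw [hW, hr]) (fun t => ?_)
  obtain ⟨a', h1, h2⟩ := surjII i0 k0 hk degs hA hF u v hu hv hvk (xx ch p) (yy ch p) z (dxx ch)
    (dyy ch) 0 0 hx (eta_ch ch p) (dd_ch ch) (Function.extend inc t 0)
  exact ⟨a', h1, fun r => by rw [hW, h2, inc_injective.extend_apply]⟩

theorem genIII (i0 : Fin n) (degs : Fin 4 → ℤ) (hF : 1 ≤ degs 3) :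
    Gen K n degs (fun a => ∀ (u : Fin n → K), u i0 = 1 →
      ¬ (CC 0 3 u 0 a = 0 ∧ ∀ j, j ≠ i0 → CC 1 3 u (Pi.single j 1) a = 0)) := by
  let τ := {j : Fin n // j ≠ i0}
  let ρ := {j : Fin n // j ≠ i0} ⊕ Fin 1
  let U : Fin n → MvPolynomial τ K := fun j => if h : j = i0 then 1 else X ⟨j, h⟩
  let row : (Fin 4 → MvPolynomial (Fin n) K) →ₗ[K] (ρ → MvPolynomial τ K) :=
    LinearMap.pi (Sum.elim (fun j => CC 1 3 U (Pi.single j.1 1)) (fun _ => CC 0 3 U 0))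
  refine (gen_disc (ρ := ρ) (τ := τ) (by simp [ρ, τ]) row).mono ?_
  rintro a ha h u hu ⟨hr0, hr1⟩
  let W : τ → K := fun j => u j
  have h1 : (fun i => aeval W (U i)) = u := by
    funext i
    by_cases h : i = i0
    · subst h; simp [U, hu]
    · simp [U, h, W]
  have h00 : (fun _ => 0 : Fin n → K) = 0 := rfl
  have w0 : ∀ a j, eval W (row a (Sum.inl j)) = CC 1 3 u (Pi.single j.1 1) a := by
    intro a j
    rw [eval_eq_aeval]
    simp only [row, LinearMap.pi_apply, Sum.elim_inl]
    rw [CC_map, h1, map_single_one]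
  have w1 : ∀ a j, eval W (row a (Sum.inr j)) = CC 0 3 u 0 a := by
    intro a j
    rw [eval_eq_aeval]
    simp only [row, LinearMap.pi_apply, Sum.elim_inr]
    rw [CC_map, h1]
    simp [h00]
  refine h W ?_ (fun t => ?_)
  · rintro (⟨j, hj⟩ | j)
    · rw [w0, hr1 j hj]
    · rw [w1, hr0]
  · obtain ⟨N', hN'⟩ : ∃ N : ℕ, degs 3 = (N + 1 : ℕ) := ⟨(degs 3 - 1).toNat, by push_cast; omega⟩
    let b : Fin n → K := fun j => if h : j = i0 then 0 else t (Sum.inl ⟨j, h⟩)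
    refine ⟨![0, 0, 0, tF i0 u N' (t (Sum.inr 0)) b], ?_, ?_⟩
    · intro i
      fin_cases i
      · intro e he; simp at he
      · intro e he; simp at he
      · intro e he; simp at he
      · exact homogZ_of (hom_tF i0 u N' _ _) hN'
    · rintro (⟨j, hj⟩ | j)
      · rw [w0]
        simp only [CC, LinearMap.comp_apply, LinearMap.proj_apply, AlgHom.toLinearMap_apply,
          Matrix.cons_val, cf_apply]
        rw [LL_tF i0 u _ hu (by simp [Ne.symm hj])]
        simp [Pi.single_apply, b, hj]
      · rw [w1]
        simp only [CC, LinearMap.comp_apply, LinearMap.proj_apply, AlgHom.toLinearMap_apply,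
          Matrix.cons_val, cf_apply]
        rw [LL_tF i0 u _ hu (by simp)]
        rw [Subsingleton.elim j 0]
        simp

theorem genIV (i0 : Fin n) (degs : Fin 4 → ℤ) (hB : 1 ≤ degs 1) (hF : 1 ≤ degs 3) :
    Gen K n degs (fun a => ∀ (u : Fin n → K) (z : K), u i0 = 1 →
      ¬ (DD 0 0 1 z 1 0 u 0 0 a = 0 ∧ DD 1 0 1 z 1 0 u 0 1 a = 0 ∧
        ∀ j, j ≠ i0 → DD 1 0 1 z 1 0 u (Pi.single j 1) 0 a = 0)) := by
  let τ := {j : Fin n // j ≠ i0} ⊕ Fin 1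
  let ρ := {j : Fin n // j ≠ i0} ⊕ Fin 2
  let U : Fin n → MvPolynomial τ K := fun j => if h : j = i0 then 1 else X (Sum.inl ⟨j, h⟩)
  let zz : MvPolynomial τ K := X (Sum.inr 0)
  let row : (Fin 4 → MvPolynomial (Fin n) K) →ₗ[K] (ρ → MvPolynomial τ K) :=
    LinearMap.pi (Sum.elim (fun j => DD 1 0 1 zz 1 0 U (Pi.single j.1 1) 0)
      ![DD 0 0 1 zz 1 0 U 0 0, DD 1 0 1 zz 1 0 U 0 1])
  refine (gen_disc (ρ := ρ) (τ := τ) (by simp [ρ, τ]) row).mono ?_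
  rintro a ha h u z hu ⟨hr0, hr1, hr2⟩
  let W : τ → K := Sum.elim (fun j => u j) (fun _ => z)
  have h1 : (fun i => aeval W (U i)) = u := by
    funext i
    by_cases h : i = i0
    · subst h; simp [U, hu]
    · simp [U, h, W]
  have h00 : (fun _ => 0 : Fin n → K) = 0 := rfl
  have hz : aeval W zz = z := by simp [zz, W]
  have w0 : ∀ a j, eval W (row a (Sum.inl j)) = DD 1 0 1 z 1 0 u (Pi.single j.1 1) 0 a := by
    intro a j
    rw [eval_eq_aeval]
    simp only [row, LinearMap.pi_apply, Sum.elim_inl]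
    rw [DD_map, h1, map_single_one, hz]
    simp
  have w1 : ∀ a, eval W (row a (Sum.inr 0)) = DD 0 0 1 z 1 0 u 0 0 a := by
    intro a
    rw [eval_eq_aeval]
    simp only [row, LinearMap.pi_apply, Sum.elim_inr, Matrix.cons_val_zero]
    rw [DD_map, h1, hz]
    simp [h00]
  have w2 : ∀ a, eval W (row a (Sum.inr 1)) = DD 1 0 1 z 1 0 u 0 1 a := by
    intro a
    rw [eval_eq_aeval]
    simp only [row, LinearMap.pi_apply, Sum.elim_inr, Matrix.cons_val_one, Matrix.cons_val_fin_one]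
    rw [DD_map, h1, hz]
    simp [h00]
  refine h W ?_ (fun t => ?_)
  · rintro (⟨j, hj⟩ | j)
    · rw [w0, hr2 j hj]
    · fin_cases j
      · exact (w1 a).trans hr0
      · exact (w2 a).trans hr1
  · obtain ⟨N, hN⟩ : ∃ N : ℕ, degs 1 = (N + 1 : ℕ) := ⟨(degs 1 - 1).toNat, by push_cast; omega⟩
    obtain ⟨N', hN'⟩ : ∃ N : ℕ, degs 3 = (N + 1 : ℕ) := ⟨(degs 3 - 1).toNat, by push_cast; omega⟩
    let b : Fin n → K := fun j => if h : j = i0 then 0 else t (Sum.inl ⟨j, h⟩)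
    have key : ∀ v : Fin n → K, v i0 = 0 → ∀ w, PL 0 1 z 1 0 u v w
        ![0, tF i0 u N (t (Sum.inr 0)) b, 0, tF i0 u N' (t (Sum.inr 1)) 0] =
        Polynomial.C (t (Sum.inr 0)) + Polynomial.C (∑ j, b j * v j + t (Sum.inr 1) * w) *
          Polynomial.X := by
      intro v hv w
      rw [PL_apply]
      simp only [Matrix.cons_val_zero, Matrix.cons_val_one, Matrix.cons_val, map_zero,
        LL_tF i0 u v hu hv]
      simp
      ring
    refine ⟨![0, tF i0 u N (t (Sum.inr 0)) b, 0, tF i0 u N' (t (Sum.inr 1)) 0], ?_, ?_⟩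
    · intro i
      fin_cases i
      · intro e he; simp at he
      · exact homogZ_of (hom_tF i0 u N _ _) hN
      · intro e he; simp at he
      · exact homogZ_of (hom_tF i0 u N' _ _) hN'
    · rintro (⟨j, hj⟩ | j)
      · rw [w0]
        simp only [DD, LinearMap.comp_apply, cf_apply]
        rw [key _ (by simp [Ne.symm hj])]
        simp [Pi.single_apply, b, hj]
      · fin_cases j
        · refine (w1 _).trans ?_
          simp only [DD, LinearMap.comp_apply, cf_apply]
          rw [key _ (by simp)]
          simp
        · refine (w2 _).trans ?_
          simp only [DD, LinearMap.comp_apply, cf_apply]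
          rw [key _ (by simp)]
          simp

end

end

section
noncomputable section
variable {K : Type} [Field K] {n : ℕ}

theorem line_coeff {σ : Type} [Fintype σ] (p t : σ → K) (g : MvPolynomial σ K) :
    (aeval (fun s => Polynomial.C (p s) + Polynomial.C (t s) * Polynomial.X) g :
      Polynomial K).coeff 0 = eval p g ∧
    (aeval (fun s => Polynomial.C (p s) + Polynomial.C (t s) * Polynomial.X) g :
      Polynomial K).coeff 1 = ∑ s, t s * eval p (pderiv s g) := by
  classical
  induction g using MvPolynomial.induction_on with
  | C a => simp [Polynomial.coeff_C]
  | add f g hf hg =>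
    simp only [map_add, Polynomial.coeff_add, hf.1, hf.2, hg.1, hg.2, mul_add,
      Finset.sum_add_distrib, and_self]
  | mul_X f i hf =>
    simp only [map_mul, aeval_X]
    constructor
    · simp [Polynomial.mul_coeff_zero, hf.1]
    · rw [mul_add, Polynomial.coeff_add, Polynomial.coeff_mul_C, hf.2, ← mul_assoc,
        Polynomial.coeff_mul_X, Polynomial.coeff_mul_C, hf.1]
      simp only [Derivation.leibniz, pderiv_X, smul_eq_mul, map_add, map_mul, eval_X, mul_add,
        Finset.sum_add_distrib]
      rw [add_comm, Finset.sum_mul]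
      congr 1
      · rw [Finset.sum_eq_single i]
        · simp; ring
        · intro b _ hb; simp [Pi.single_apply, Ne.symm hb]
        · simp
      · refine Finset.sum_congr rfl fun s _ => ?_
        ring

theorem LL_coeff_zero (u v : Fin n → K) (g : MvPolynomial (Fin n) K) :
    (LL u v g).coeff 0 = eval u g := (line_coeff u v g).1

theorem LL_coeff_one (u v : Fin n → K) (g : MvPolynomial (Fin n) K) :
    (LL u v g).coeff 1 = ∑ s, v s * eval u (pderiv s g) := (line_coeff u v g).2

/-- extension of a chart direction -/
def ext0 (i0 : Fin n) (v : {j : Fin n // j ≠ i0} ⊕ Fin 1 → K) : Fin n → K :=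
  fun j => if h : j = i0 then 0 else v (Sum.inl ⟨j, h⟩)

theorem ext0_i0 (i0 : Fin n) (v : {j : Fin n // j ≠ i0} ⊕ Fin 1 → K) : ext0 i0 v i0 = 0 := by
  simp [ext0]

theorem ext0_ne (i0 : Fin n) (v : {j : Fin n // j ≠ i0} ⊕ Fin 1 → K) (j : Fin n) (h : j ≠ i0) :
    ext0 i0 v j = v (Sum.inl ⟨j, h⟩) := by
  simp [ext0, h]

theorem ext0_add (i0 : Fin n) (v w : {j : Fin n // j ≠ i0} ⊕ Fin 1 → K) :
    ext0 i0 (v + w) = ext0 i0 v + ext0 i0 w := by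
  funext j
  by_cases h : j = i0 <;> simp [ext0, h]

theorem ext0_inl (i0 : Fin n) (j : Fin n) (h : j ≠ i0) :
    ext0 i0 (Pi.single (Sum.inl ⟨j, h⟩) 1 : _ → K) = Pi.single j 1 := by
  funext k
  by_cases hk : k = i0
  · subst hk; simp [ext0, Ne.symm h]
  · simp only [ext0, dif_neg hk, Pi.single_apply, Sum.inl.injEq, Subtype.mk.injEq]

theorem ext0_inr (i0 : Fin n) : 
    ext0 i0 (Pi.single (Sum.inr 0) 1 : {j : Fin n // j ≠ i0} ⊕ Fin 1 → K) = 0 := by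
  funext k
  simp [ext0]

theorem lineP_localAt (i0 : Fin n) (u : Fin n → K) (hu : u i0 = 1) (y0 : K)
    (G : MvPolynomial (Fin n ⊕ Fin 1) K) (v) :
    lineP (localAt K i0 u y0 G) v =
      aeval (Sum.elim (fun j => Polynomial.C (u j) + Polynomial.C (ext0 i0 v j) * Polynomial.X)
        (fun _ => Polynomial.C y0 + Polynomial.C (v (Sum.inr 0)) * Polynomial.X)) G := by
  rw [lineP, localAt, ← AlgHom.comp_apply]
  congr 1
  apply MvPolynomial.algHom_ext
  rintro (j | j)
  · by_cases h : j = i0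
    · subst h; simp [ext0, hu]
    · simp [ext0, h, add_comm]
  · simp [add_comm]

theorem aeval_rename_inl {T : Type} (u v : Fin n → K) (f : T → Polynomial K)
    (g : MvPolynomial (Fin n) K) :
    aeval (Sum.elim (fun j => Polynomial.C (u j) + Polynomial.C (v j) * Polynomial.X) f)
      (rename Sum.inl g) = LL u v g := by
  rw [aeval_rename]
  rfl

theorem lineP_X (i0 : Fin n) (u : Fin n → K) (hu : u i0 = 1) (y0 z : K)
    (a : Fin 4 → MvPolynomial (Fin n) K) (v) :
    lineP (localAt K i0 u y0 (chartPolyX K a)) v =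
      LL u (ext0 i0 v) (a 2) * PL (xx true y0) (yy true y0) z (dxx true) (dyy true) u (ext0 i0 v)
        (v (Sum.inr 0)) a - Polynomial.C z * LL u (ext0 i0 v) (a 2) ^ 2 := by
  rw [lineP_localAt i0 u hu, chartPolyX, PL_apply]
  simp only [map_mul, map_add, map_pow, aeval_rename_inl, aeval_X, Sum.elim_inr, xx, yy, dxx, dyy,
    map_one, map_zero]
  ring

theorem lineP_Y (i0 : Fin n) (u : Fin n → K) (hu : u i0 = 1) (y0 z : K)
    (a : Fin 4 → MvPolynomial (Fin n) K) (v) :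
    lineP (localAt K i0 u y0 (chartPolyY K a)) v =
      LL u (ext0 i0 v) (a 2) * PL (xx false y0) (yy false y0) z (dxx false) (dyy false) u
        (ext0 i0 v) (v (Sum.inr 0)) a - Polynomial.C z * LL u (ext0 i0 v) (a 2) ^ 2 := by
  rw [lineP_localAt i0 u hu, chartPolyY, PL_apply]
  simp only [map_mul, map_add, map_pow, aeval_rename_inl, aeval_X, Sum.elim_inr, xx, yy, dxx, dyy,
    map_one, map_zero]
  ring

theorem line_Z (u : Fin n → K) (v0 : Fin 3 → K) (v : Fin n → K) (w dx dy tz : K)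
    (a : Fin 4 → MvPolynomial (Fin n) K) :
    aeval (fun s => Polynomial.C (Sum.elim u v0 s) +
      Polynomial.C (Sum.elim v ![w * dx, w * dy, tz] s) * Polynomial.X) (specialMemberZ K a) =
    PL (v0 0) (v0 1) (v0 2) dx dy u v w a + LL u v (a 2) * Polynomial.C tz * Polynomial.X := by
  have h : (fun s => Polynomial.C (Sum.elim u v0 s) +
      Polynomial.C (Sum.elim v ![w * dx, w * dy, tz] s) * Polynomial.X) =
      Sum.elim (fun j => Polynomial.C (u j) + Polynomial.C (v j) * Polynomial.X)
        (fun j => Polynomial.C (v0 j) + Polynomial.C (![w * dx, w * dy, tz] j) * Polynomial.X) := by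
    funext s
    rcases s with s | s <;> rfl
  rw [h, specialMemberZ, PL_apply]
  simp only [map_mul, map_add, map_pow, aeval_rename_inl, aeval_X, Sum.elim_inr,
    Matrix.cons_val_zero, Matrix.cons_val_one, Matrix.cons_val]
  ring

theorem PL_coeff_zero (x y z dx dy : K) (u v : Fin n → K) (w : K)
    (a : Fin 4 → MvPolynomial (Fin n) K) :
    (PL x y z dx dy u v w a).coeff 0 = eval u (a 0) * x ^ 2 + eval u (a 1) * y ^ 2 +
      eval u (a 2) * z + eval u (a 3) * x * y := by
  simp [PL_apply, Polynomial.mul_coeff_zero, LL_coeff_zero, pow_two]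

theorem crit_facts (u : Fin n → K) (v0 : Fin 3 → K) (i0 : Fin n) (jf : Fin 3) (dx dy : K)
    (hj : (![dx, dy, 0] : Fin 3 → K) jf = 0) (hj2 : jf ≠ 2)
    (a : Fin 4 → MvPolynomial (Fin n) K)
    (hz : evalPt K (u, v0) (specialMemberZ K a) = 0)
    (hc : CriticalPointOfZbar K (specialMemberZ K a) i0 jf (u, v0)) :
    eval u (a 2) ≠ 0 ∧
    (∀ v w, (PL (v0 0) (v0 1) (v0 2) dx dy u v w a).coeff 0 = 0) ∧
    (∀ v w, v i0 = 0 → (PL (v0 0) (v0 1) (v0 2) dx dy u v w a).coeff 1 = 0) := by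
  have key : ∀ (v : Fin n → K) (w tz : K), v i0 = 0 →
      (PL (v0 0) (v0 1) (v0 2) dx dy u v w a).coeff 1 + eval u (a 2) * tz = 0 → tz = 0 := by
    intro v w tz hv h
    have h1 := (line_coeff (Sum.elim u v0) (Sum.elim v ![w * dx, w * dy, tz])
      (specialMemberZ K a)).2
    rw [line_Z, Polynomial.coeff_add, Polynomial.coeff_mul_X, Polynomial.coeff_mul_C,
      LL_coeff_zero, h] at h1
    have := hc (Sum.elim v ![w * dx, w * dy, tz]) (by simpa using hv) ?_ h1.symm
    · simpa using this
    · fin_cases jf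
      · have : dx = 0 := by simpa using hj
        simp [this]
      · have : dy = 0 := by simpa using hj
        simp [this]
      · exact absurd rfl hj2
  have hc0 : eval u (a 2) ≠ 0 := by
    intro h
    have : (PL (v0 0) (v0 1) (v0 2) dx dy u 0 0 a).coeff 1 = 0 := by
      have h1 := (line_coeff (Sum.elim u v0) (Sum.elim 0 ![0 * dx, 0 * dy, 0])
        (specialMemberZ K a)).2
      rw [line_Z] at h1
      simp only [map_zero, mul_zero, zero_mul, add_zero] at h1
      rw [h1]
      refine Finset.sum_eq_zero fun s _ => ?_
      rcases s with s | s
      · simp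
      · fin_cases s <;> simp
    exact one_ne_zero (key 0 0 1 rfl (by rw [this, h]; simp))
  refine ⟨hc0, ?_, ?_⟩
  · intro v w
    rw [PL_coeff_zero]
    have h0 := (line_coeff (Sum.elim u v0) (Sum.elim 0 ![0 * dx, 0 * dy, 0])
        (specialMemberZ K a)).1
    rw [line_Z, Polynomial.coeff_add, Polynomial.mul_coeff_zero, PL_coeff_zero] at h0
    simp only [Polynomial.coeff_X_zero, mul_zero, add_zero] at h0
    rw [h0]
    exact hz
  · intro v w hv
    have := key v w (-(PL (v0 0) (v0 1) (v0 2) dx dy u v w a).coeff 1 / eval u (a 2)) hv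
      (by field_simp; ring)
    simpa [hc0] using this

theorem PL_expand [CharP K 2] (x y z dx dy : K) (hη : dx * y + dy * x = 1) (hd : dx * dy = 0)
    (u v : Fin n → K) (w : K) (a : Fin 4 → MvPolynomial (Fin n) K) :
    PL x y z dx dy u v w a =
      LL u v (a 0) * (Polynomial.C (x ^ 2) + Polynomial.C (w ^ 2 * dx ^ 2) * Polynomial.X ^ 2) +
      LL u v (a 1) * (Polynomial.C (y ^ 2) + Polynomial.C (w ^ 2 * dy ^ 2) * Polynomial.X ^ 2) +
      LL u v (a 2) * Polynomial.C z +
      LL u v (a 3) * (Polynomial.C (x * y) + Polynomial.C w * Polynomial.X) := by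
  have h2 : (2 : Polynomial K) = 0 := by
    have := CharTwo.two_eq_zero (R := K)
    rw [← map_ofNat Polynomial.C 2, this, map_zero]
  have hη' := congrArg Polynomial.C hη
  have hd' := congrArg Polynomial.C hd
  rw [PL_apply]
  simp only [map_mul, map_add, map_pow, map_one, map_zero] at hη' hd' ⊢
  linear_combination LL u v (a 3) *
      (Polynomial.C w * Polynomial.X * hη' + Polynomial.C w ^ 2 * Polynomial.X ^ 2 * hd') +
    LL u v (a 0) * Polynomial.C x * Polynomial.C w * Polynomial.C dx * Polynomial.X * h2 +
    LL u v (a 1) * Polynomial.C y * Polynomial.C w * Polynomial.C dy * Polynomial.X * h2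

theorem LL_zero_dir (u : Fin n → K) (g : MvPolynomial (Fin n) K) :
    LL u 0 g = Polynomial.C (eval u g) := by
  induction g using MvPolynomial.induction_on with
  | C a => simp [LL]
  | add f g hf hg => simp only [map_add, hf, hg]
  | mul_X f i hf => rw [map_mul, hf]; simp [LL]

theorem typeIII_facts [CharP K 2] (x y z dx dy : K) (hη : dx * y + dy * x = 1) (hd : dx * dy = 0)
    (u v : Fin n → K) (a : Fin 4 → MvPolynomial (Fin n) K) :
    BB x y z dx dy u 0 1 v 0 a = CC 1 3 u v a ∧
    (PL x y z dx dy u 0 1 a).coeff 1 = CC 0 3 u 0 a := by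
  have e : ∀ (L : Polynomial K) (c d : K),
      (L * (Polynomial.C c + Polynomial.C d * Polynomial.X ^ 2)).coeff 2 =
        L.coeff 2 * c + L.coeff 0 * d := by
    intro L c d
    rw [mul_add, Polynomial.coeff_add, Polynomial.coeff_mul_C, ← mul_assoc,
      Polynomial.coeff_mul_X_pow' , if_pos le_rfl, Polynomial.coeff_mul_C]
  have e' : ∀ (L : Polynomial K) (c d : K),
      (L * (Polynomial.C c + Polynomial.C d * Polynomial.X)).coeff 2 =
        L.coeff 2 * c + L.coeff 1 * d := by
    intro L c d
    rw [mul_add, Polynomial.coeff_add, Polynomial.coeff_mul_C, ← mul_assoc,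
      Polynomial.coeff_mul_X, Polynomial.coeff_mul_C]
  constructor
  · simp only [BB, DD, CC, LinearMap.sub_apply, LinearMap.comp_apply, cf_apply, zero_add, add_zero,
      PL_expand x y z dx dy hη hd, Polynomial.coeff_add, e, e', Polynomial.coeff_mul_C,
      LL_zero_dir, LL_coeff_zero, AlgHom.toLinearMap_apply, LinearMap.proj_apply]
    simp [Polynomial.coeff_C]
    ring
  · rw [PL_expand x y z dx dy hη hd]
    simp only [CC, cf_apply, LL_zero_dir, LinearMap.comp_apply, AlgHom.toLinearMap_apply,
      LinearMap.proj_apply, Polynomial.coeff_add, Polynomial.coeff_C_mul, Polynomial.coeff_C,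
      Polynomial.coeff_X_pow, Polynomial.coeff_X]
    norm_num

theorem lineP_smul {ι : Type} (F : MvPolynomial ι K) (c : K) (v : ι → K) (k : ℕ) :
    (lineP F (c • v)).coeff k = (lineP F v).coeff k * c ^ k := by
  have : lineP F (c • v) = (lineP F v).comp (Polynomial.C c * Polynomial.X) := by
    induction F using MvPolynomial.induction_on with
    | C a => simp [lineP]
    | add f g hf hg =>
      have : ∀ v, lineP (f + g) v = lineP f v + lineP g v := fun v => by simp [lineP]
      rw [this, this, hf, hg, Polynomial.add_comp]
    | mul_X f i hf =>
      rw [lineP_mul_X, lineP_mul_X, hf]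
      simp
      ring
  rw [this, Polynomial.comp_C_mul_X_coeff]

end

end

section
noncomputable section
variable {K : Type} [Field K] {n : ℕ}

def PredI (n : ℕ) (i0 k0 : Fin n) (ch : Bool) (a : Fin 4 → MvPolynomial (Fin n) K) : Prop :=
  ∀ (u v : Fin n → K) (p z : K), u i0 = 1 → v i0 = 0 → v k0 = 1 →
      xx ch p ≠ 0 →
      ¬ ∀ r, rowII i0 k0 (xx ch p) (yy ch p) z (dxx ch) (dyy ch) u v 0 0 a (inc r) = 0

def PredII (n : ℕ) (i0 k0 : Fin n) (ch : Bool) (a : Fin 4 → MvPolynomial (Fin n) K) : Prop :=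
  ∀ (u v : Fin n → K) (p z w s : K), u i0 = 1 → v i0 = 0 → v k0 = 1 →
      xx ch p ≠ 0 →
      ¬ ∀ r, rowII i0 k0 (xx ch p) (yy ch p) z (dxx ch) (dyy ch) u v w s a r = 0

def PredIII (n : ℕ) (i0 : Fin n) (a : Fin 4 → MvPolynomial (Fin n) K) : Prop :=
  ∀ (u : Fin n → K), u i0 = 1 →
      ¬ (CC 0 3 u 0 a = 0 ∧ ∀ j, j ≠ i0 → CC 1 3 u (Pi.single j 1) a = 0)

theorem prod_coeff [CharP K 2] (L P : Polynomial K) (z : K) (h0 : P.coeff 0 = 0)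
    (h1 : P.coeff 1 = 0) :
    (L * P - Polynomial.C z * L ^ 2).coeff 1 = 0 ∧
    (L * P - Polynomial.C z * L ^ 2).coeff 2 = L.coeff 0 * P.coeff 2 - z * L.coeff 1 ^ 2 ∧
    (L * P - Polynomial.C z * L ^ 2).coeff 3 = L.coeff 0 * P.coeff 3 + L.coeff 1 * P.coeff 2 := by
  have h2 : (2 : K) = 0 := CharTwo.two_eq_zero
  rw [pow_two]
  simp only [Polynomial.coeff_sub, Polynomial.coeff_C_mul, Polynomial.coeff_mul,
    Finset.Nat.antidiagonal_succ, Finset.Nat.antidiagonal_zero, Finset.sum_cons,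
    Finset.map_cons, Finset.map_singleton, Finset.sum_singleton]
  simp [h0, h1]
  refine ⟨?_, ?_, ?_⟩
  · right; linear_combination L.coeff 0 * L.coeff 1 * h2
  · left; linear_combination L.coeff 0 * L.coeff 2 * h2
  · right; linear_combination (L.coeff 0 * L.coeff 3 + L.coeff 1 * L.coeff 2) * h2

theorem core [IsAlgClosed K] [CharP K 2] (i0 : Fin n) (ch : Bool) (p z : K) (u : Fin n → K)
    (hu : u i0 = 1) (a : Fin 4 → MvPolynomial (Fin n) K) (hx : xx ch p ≠ 0)
    (hI : ∀ k0, k0 ≠ i0 → PredI n i0 k0 ch a) (hII : ∀ k0, k0 ≠ i0 → PredII n i0 k0 ch a)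
    (hIII : PredIII n i0 a)
    (F : MvPolynomial ({j : Fin n // j ≠ i0} ⊕ Fin 1) K)
    (hF : ∀ v, lineP F v =
      LL u (ext0 i0 v) (a 2) * PL (xx ch p) (yy ch p) z (dxx ch) (dyy ch) u
        (ext0 i0 v) (v (Sum.inr 0)) a - Polynomial.C z * LL u (ext0 i0 v) (a 2) ^ 2)
    (hc : eval u (a 2) ≠ 0)
    (hP0 : ∀ v w, (PL (xx ch p) (yy ch p) z (dxx ch) (dyy ch) u v w a).coeff 0 = 0)
    (hP1 : ∀ v w, v i0 = 0 →
      (PL (xx ch p) (yy ch p) z (dxx ch) (dyy ch) u v w a).coeff 1 = 0) :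
    AdmissibleLocalFunction K F := by
  have h2 : (2 : K) = 0 := CharTwo.two_eq_zero
  have hcoef := fun v => prod_coeff (LL u (ext0 i0 v) (a 2)) (PL (xx ch p) (yy ch p) z (dxx ch)
    (dyy ch) u (ext0 i0 v) (v (Sum.inr 0)) a) z (hP0 _ _) (hP1 _ _ (ext0_i0 i0 v))
  simp only [← hF, LL_coeff_zero] at hcoef
  obtain ⟨l, q, hlq⟩ := lineP_quad F
  have hq := fun v => (hlq v).2
  have hpol : ∀ v w, QuadraticMap.polar q v w = eval u (a 2) *
      BB (xx ch p) (yy ch p) z (dxx ch) (dyy ch) u (ext0 i0 v) (v (Sum.inr 0)) (ext0 i0 w)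
        (w (Sum.inr 0)) a := by
    intro v w
    have hadd : (LL u (ext0 i0 (v + w)) (a 2)).coeff 1 =
        (LL u (ext0 i0 v) (a 2)).coeff 1 + (LL u (ext0 i0 w) (a 2)).coeff 1 := by
      simp only [LL_coeff_one, ext0_add, Pi.add_apply, add_mul, Finset.sum_add_distrib]
    rw [QuadraticMap.polar, ← hq, ← hq, ← hq, (hcoef _).2.1, (hcoef _).2.1, (hcoef _).2.1, hadd]
    simp only [BB, DD, LinearMap.sub_apply, LinearMap.comp_apply, cf_apply, ext0_add, Pi.add_apply]
    linear_combination -z * (LL u (ext0 i0 v) (a 2)).coeff 1 *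
      (LL u (ext0 i0 w) (a 2)).coeff 1 * h2
  have hrad : ∀ v, (∀ w, QuadraticMap.polar q v w = 0) → ∀ w,
      BB (xx ch p) (yy ch p) z (dxx ch) (dyy ch) u (ext0 i0 v) (v (Sum.inr 0)) (ext0 i0 w)
        (w (Sum.inr 0)) a = 0 := by
    intro v hv w
    have := hv w
    rw [hpol] at this
    exact (mul_eq_zero.mp this).resolve_left hc
  have hradc : ∀ (c : K) v, (∀ w, QuadraticMap.polar q v w = 0) →
      (∀ w, QuadraticMap.polar q (c • v) w = 0) := by
    intro c v hv w
    rw [QuadraticMap.polar_smul_left, hv, smul_zero]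
  -- rows that vanish
  have hrow : ∀ (v : {j : Fin n // j ≠ i0} ⊕ Fin 1 → K) (k0 : Fin n) (s : K),
      (∀ w, QuadraticMap.polar q v w = 0) → ∀ r,
      rowII i0 k0 (xx ch p) (yy ch p) z (dxx ch) (dyy ch) u (ext0 i0 v) (v (Sum.inr 0)) s a
        (inc r) = 0 := by
    intro v k0 s hv r
    have hb := hrad v hv
    rcases r with ⟨j, hj⟩ | ⟨j, hj⟩ | r
    · exact hP1 _ _ (by simp [Ne.symm hj])
    · have := hb (Pi.single (Sum.inl ⟨j, hj.1⟩) 1)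
      rw [ext0_inl] at this
      simp only [ne_eq, reduceCtorEq, not_false_eq_true, Pi.single_eq_of_ne] at this
      exact this
    · fin_cases r
      · exact hP0 _ _
      · exact hP1 _ _ rfl
      · have := hb (Pi.single (Sum.inr 0) 1)
        rw [ext0_inr, Pi.single_eq_same] at this
        exact this
  refine adm_of (fun v => (hcoef v).1) q hq (Sum.inr 0) ?_ ?_
  · intro v hv hvt
    by_contra hv0
    obtain ⟨k0, hk0⟩ : ∃ k : {j : Fin n // j ≠ i0}, v (Sum.inl k) ≠ 0 := by
      by_contra hcon
      push Not at hcon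
      apply hv0
      funext s
      rcases s with s | s
      · exact hcon s
      · rw [Subsingleton.elim s 0]; exact hvt
    have hv' := hradc (v (Sum.inl k0))⁻¹ v hv
    have := hrow _ k0 0 hv'
    have ht : ((v (Sum.inl k0))⁻¹ • v) (Sum.inr 0) = 0 := by simp [hvt]
    rw [ht] at this
    exact hI k0 k0.2 u _ p z hu (ext0_i0 _ _) (by rw [ext0_ne _ _ _ k0.2]; simp [hk0]) hx this
  · intro v hv hv0 h3
    by_cases hcon : ∃ k : {j : Fin n // j ≠ i0}, v (Sum.inl k) ≠ 0
    · obtain ⟨k0, hk0⟩ := hcon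
      have hv' := hradc (v (Sum.inl k0))⁻¹ v hv
      have h3' : (lineP F ((v (Sum.inl k0))⁻¹ • v)).coeff 3 = 0 := by
        rw [lineP_smul, h3, zero_mul]
      have hvk : ext0 i0 ((v (Sum.inl k0))⁻¹ • v) k0 = 1 := by
        rw [ext0_ne _ _ _ k0.2]; simp [hk0]
      generalize (v (Sum.inl k0))⁻¹ • v = v' at hv' h3' hvk
      let s := (PL (xx ch p) (yy ch p) z (dxx ch) (dyy ch) u (ext0 i0 v') (v' (Sum.inr 0)) a).coeff 2
        / eval u (a 2)
      have h4 := hrow v' k0 s hv'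
      refine hII k0 k0.2 u (ext0 i0 v') p z (v' (Sum.inr 0)) s hu (ext0_i0 _ _) hvk hx ?_
      rintro (j | j | r)
      · exact h4 (Sum.inl j)
      · exact h4 (Sum.inr (Sum.inl j))
      · fin_cases r
        · exact h4 (Sum.inr (Sum.inr 0))
        · exact h4 (Sum.inr (Sum.inr 1))
        · exact h4 (Sum.inr (Sum.inr 2))
        · simp [rowII, DD, CC, cf_apply, LL_coeff_zero, s]
          field_simp
          ring
        · rw [(hcoef _).2.2] at h3'
          simp [rowII, DD, CC, cf_apply, s]
          field_simp
          linear_combination h3' - (LL u (ext0 i0 v') (a 2)).coeff 1 * (PL (xx ch p) (yy ch p) z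
            (dxx ch) (dyy ch) u (ext0 i0 v') (v' (Sum.inr 0)) a).coeff 2 * h2
    · push Not at hcon
      have hvt : v (Sum.inr 0) ≠ 0 := by
        intro hvt
        apply hv0
        funext s
        rcases s with s | s
        · exact hcon s
        · rw [Subsingleton.elim s 0]; exact hvt
      have hv' := hrad _ (hradc (v (Sum.inr 0))⁻¹ v hv)
      have e1 : ext0 i0 ((v (Sum.inr 0))⁻¹ • v) = 0 := by
        funext j
        by_cases h : j = i0
        · subst h; simp [ext0]
        · simp [ext0, h, hcon]
      have e2 : ((v (Sum.inr 0))⁻¹ • v) (Sum.inr 0) = 1 := by simp [hvt]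
      rw [e1, e2] at hv'
      refine hIII u hu ⟨?_, ?_⟩
      · rw [← (typeIII_facts (xx ch p) (yy ch p) z (dxx ch) (dyy ch) (eta_ch ch p) (dd_ch ch)
          u 0 a).2]
        exact hP1 _ _ rfl
      · intro j hj
        rw [← (typeIII_facts (xx ch p) (yy ch p) z (dxx ch) (dyy ch) (eta_ch ch p) (dd_ch ch)
          u _ a).1]
        have := hv' (Pi.single (Sum.inl ⟨j, hj⟩) 1)
        rw [ext0_inl] at this
        simp only [ne_eq, reduceCtorEq, not_false_eq_true, Pi.single_eq_of_ne] at this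
        exact this

end

theorem final_thm
    (K : Type) [Field K] [IsAlgClosed K] [CharP K 2]
    (n : ℕ) (hn : 3 ≤ n) (lam mu nu : ℤ)
    (h0 : 0 < lam) (h1 : lam ≤ mu) (h2 : mu ≤ nu) (h3 : nu ≤ lam + mu)
    (h4 : 3 ≤ nu) :
    GenerallyHolds4 K n ![-lam + mu + nu, lam - mu + nu, lam + mu - nu, nu]
      (fun abcf =>
        (∀ (i0 : Fin n) (u0 : Fin n → K) (v0 : Fin 3 → K),
          u0 i0 = 1 → v0 0 = 1 →
          evalPt K (u0, v0) (specialMemberZ K abcf) = 0 →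
          CriticalPointOfZbar K (specialMemberZ K abcf) i0 0 (u0, v0) →
          AdmissibleLocalFunction K (localAt K i0 u0 (v0 1) (chartPolyX K abcf))) ∧
        (∀ (i0 : Fin n) (u0 : Fin n → K) (v0 : Fin 3 → K),
          u0 i0 = 1 → v0 1 = 1 →
          evalPt K (u0, v0) (specialMemberZ K abcf) = 0 →
          CriticalPointOfZbar K (specialMemberZ K abcf) i0 1 (u0, v0) →
          AdmissibleLocalFunction K (localAt K i0 u0 (v0 0) (chartPolyY K abcf)))) := by
  have : Infinite K := IsAlgClosed.instInfinite
  apply Gen.generally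
  set degs : Fin 4 → ℤ := ![-lam + mu + nu, lam - mu + nu, lam + mu - nu, nu] with hdegs
  have hA : 3 ≤ degs 0 := by simp [hdegs]; omega
  have hB : 1 ≤ degs 1 := by simp [hdegs]; omega
  have hF : 1 ≤ degs 3 := by simp [hdegs]; omega
  have gI : Gen K n degs (fun a => ∀ (ch : Bool) (i0 : Fin n) (k0 : Fin n), k0 ≠ i0 →
      PredI n i0 k0 ch a) := by
    refine Gen.forall fun ch => Gen.forall fun i0 => Gen.forall fun k0 => ?_
    by_cases hk : k0 = i0
    · exact Gen.trivial fun a h => absurd hk h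
    · exact (genI i0 k0 hk degs hA hF ch).mono fun a _ h _ => h
  have gII : Gen K n degs (fun a => ∀ (ch : Bool) (i0 : Fin n) (k0 : Fin n), k0 ≠ i0 →
      PredII n i0 k0 ch a) := by
    refine Gen.forall fun ch => Gen.forall fun i0 => Gen.forall fun k0 => ?_
    by_cases hk : k0 = i0
    · exact Gen.trivial fun a h => absurd hk h
    · exact (genII i0 k0 hk degs hA hF ch).mono fun a _ h _ => h
  have gIII : Gen K n degs (fun a => ∀ i0 : Fin n, PredIII n i0 a) :=
    Gen.forall fun i0 => genIII i0 degs hF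
  have gIV := Gen.forall (fun i0 : Fin n => genIV (K := K) i0 degs hB hF)
  refine (((gI.and gII).and gIII).and gIV).mono ?_
  rintro a - ⟨⟨⟨hI, hII⟩, hIII⟩, hIV⟩
  constructor
  · intro i0 u v0 hu hv hz hcrit
    obtain ⟨c0, c1, c2⟩ := crit_facts u v0 i0 0 0 1 (by simp) (by decide) a hz hcrit
    rw [hv] at c1 c2
    exact core i0 true (v0 1) (v0 2) u hu a (by simp [xx]) (hI true i0) (hII true i0) (hIII i0) _
      (lineP_X i0 u hu (v0 1) (v0 2) a) c0 c1 c2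
  · intro i0 u v0 hu hv hz hcrit
    obtain ⟨c0, c1, c2⟩ := crit_facts u v0 i0 1 1 0 (by simp) (by decide) a hz hcrit
    rw [hv] at c1 c2
    by_cases hx : v0 0 = 0
    · exfalso
      rw [hx] at c1 c2
      exact hIV i0 u (v0 2) hu ⟨c1 _ _, c2 _ _ rfl, fun j hj => c2 _ _ (by simp [Ne.symm hj])⟩
    · exact core i0 false (v0 0) (v0 2) u hu a (by simpa [xx] using hx) (hI false i0)
        (hII false i0) (hIII i0) _ (lineP_Y i0 u hu (v0 0) (v0 2) a) c0 c1 c2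

end

/-- **Lemma 3.8.**  Over an algebraically closed field of characteristic 2, the
section `z̄ ∈ H⁰(Z, 𝓛²)` has only admissible critical points on `Z°`: at every
point of `Z°` (normalized to `u_{i0} = 1` and `x = 1`, resp. `y = 1`) at which
`z̄` is critical, the local expression of `z̄` (with respect to the local generator
`c·ξ` of `𝓛`, i.e. the polynomial `c(a + by² + fy)`, resp. `c(ax² + b + fx)`,
translated to the origin) has an admissible critical point. -/
theorem lem_only_admissible_critical_points
    (K : Type) [Field K] [IsAlgClosed K] [CharP K 2]
    (n : ℕ) (hn : 3 ≤ n) (lam mu nu : ℤ)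
    (h0 : 0 < lam) (h1 : lam ≤ mu) (h2 : mu ≤ nu) (h3 : nu ≤ lam + mu)
    (h4 : 3 ≤ nu) :
    GenerallyHolds4 K n ![-lam + mu + nu, lam - mu + nu, lam + mu - nu, nu]
      (fun abcf =>
        (∀ (i0 : Fin n) (u0 : Fin n → K) (v0 : Fin 3 → K),
          u0 i0 = 1 → v0 0 = 1 →
          evalPt K (u0, v0) (specialMemberZ K abcf) = 0 →
          CriticalPointOfZbar K (specialMemberZ K abcf) i0 0 (u0, v0) →
          AdmissibleLocalFunction K (localAt K i0 u0 (v0 1) (chartPolyX K abcf))) ∧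
        (∀ (i0 : Fin n) (u0 : Fin n → K) (v0 : Fin 3 → K),
          u0 i0 = 1 → v0 1 = 1 →
          evalPt K (u0, v0) (specialMemberZ K abcf) = 0 →
          CriticalPointOfZbar K (specialMemberZ K abcf) i0 1 (u0, v0) →
          AdmissibleLocalFunction K (localAt K i0 u0 (v0 0) (chartPolyY K abcf)))) := by
  exact final_thm K n hn lam mu nu h0 h1 h2 h3 h4

end ConicBundleFormalization
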